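/- arXiv:0704.0324 — 12 statements merged into one kernel-verified Lean document; each statement's English description precedes it below -/
import Mathlib

section
/- Let n ≥ 1 and let q : ℝⁿ × ℝⁿ → ℂ be a complex-valued elliptic quadratic form. If n ≥ 2, or if n = 1 and the numerical range Σ(q) is not equal to all of ℂ, then there exists a nonzero complex number z such that the real quadratic form X ↦ Re(z·q(X)) is positive definite. -/
/-- A map `q : E → ℂ` is a complex-valued quadratic form if it is given by a
real-bilinear map evaluated on the diagonal. -/
def IsCQuadForm {E : Type*} [AddCommGroup E] [Module ℝ E] (q : E → ℂ) : Prop :=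
  ∃ B : E →ₗ[ℝ] E →ₗ[ℝ] ℂ, ∀ X, q X = B X X

/-- A complex-valued quadratic form is the diagonal of a symmetric bilinear map. -/
theorem IsCQuadForm.exists_symm {E : Type*} [AddCommGroup E] [Module ℝ E] {q : E → ℂ}
    (hq : IsCQuadForm q) :
    ∃ B : E →ₗ[ℝ] E →ₗ[ℝ] ℂ, (∀ X Y, B X Y = B Y X) ∧ ∀ X, q X = B X X := by
  obtain ⟨B, hB⟩ := hq
  refine ⟨(1 / 2 : ℝ) • (B + B.flip), fun X Y => ?_, fun X => ?_⟩
  · simp [add_comm]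
  · simp only [hB, LinearMap.smul_apply, LinearMap.add_apply, LinearMap.flip_apply,
      Complex.real_smul]
    push_cast
    ring

section Bilinear

variable {E : Type*} [AddCommGroup E] [Module ℝ E] {B : E →ₗ[ℝ] E →ₗ[ℝ] ℂ}

theorem LinearMap.apply_self_smul_add_smul (hB : ∀ X Y, B X Y = B Y X) (x y : ℝ) (X Y : E) :
    B (x • X + y • Y) (x • X + y • Y) =
      x ^ 2 * B X X + y ^ 2 * B Y Y + 2 * x * y * B X Y := by
  simp only [map_add, map_smul, LinearMap.add_apply, LinearMap.smul_apply, Complex.real_smul,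
    hB Y X]
  ring

theorem LinearMap.smul_add_smul_eq_zero_of_opposite_values
    {X Y : E} (hX : B X X = 1) (hY : B Y Y = -1) {x y : ℝ} (h : x • X + y • Y = 0) :
    x = 0 ∧ y = 0 := by
  have h1 : B (x • X) (x • X) = B (y • Y) (y • Y) := by
    rw [eq_neg_of_add_eq_zero_left h]; simp
  have h2 : x * x + y * y = 0 := by
    simp only [map_smul, LinearMap.smul_apply, Complex.real_smul, hX, hY] at h1
    have := congrArg Complex.re h1
    simp at this
    linarith
  exact mul_self_add_mul_self_eq_zero.mp h2

/-- An elliptic form taking the values `1` and `-1` takes every complex value: on the plane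
spanned by the corresponding vectors it is a linear image of complex squaring. -/
theorem LinearMap.surjective_apply_self_of_opposite_values (hB : ∀ X Y, B X Y = B Y X)
    (hell : ∀ X, B X X = 0 → X = 0) {X Y : E} (hX : B X X = 1) (hY : B Y Y = -1) (w : ℂ) :
    ∃ V, B V V = w := by
  have hb : (B X Y).im ≠ 0 := by
    intro hb
    set a := (B X Y).re with ha
    have hBa : B X Y = a := Complex.ext rfl (by simpa using hb)
    have hs : Real.sqrt (a ^ 2 + 1) ^ 2 = a ^ 2 + 1 := Real.sq_sqrt (by positivity)
    have h := hell ((-a + Real.sqrt (a ^ 2 + 1)) • X + (1 : ℝ) • Y) (by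
      rw [apply_self_smul_add_smul hB, hX, hY, hBa]
      have hs' : (Real.sqrt (a ^ 2 + 1) : ℂ) ^ 2 = a ^ 2 + 1 := by exact_mod_cast hs
      push_cast
      linear_combination hs')
    exact one_ne_zero (smul_add_smul_eq_zero_of_opposite_values hX hY h).2
  obtain ⟨s, hs⟩ := IsAlgClosed.exists_pow_nat_eq
    (⟨w.re - (B X Y).re * (w.im / (B X Y).im), w.im / (B X Y).im⟩ : ℂ) zero_lt_two
  refine ⟨s.re • X + s.im • Y, ?_⟩
  rw [apply_self_smul_add_smul hB, hX, hY]
  have h1 := congrArg Complex.re hs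
  have h2 := congrArg Complex.im hs
  simp [pow_two] at h1 h2
  have h3 : (s.re * s.im + s.im * s.re) * (B X Y).im = w.im := by
    rw [h2]; field_simp
  apply Complex.ext
  · simp [pow_two]
    linear_combination h1 + (B X Y).re * h2
  · simp [pow_two]
    linear_combination h3

end Bilinear

section Normed

variable {E : Type*} [NormedAddCommGroup E] [NormedSpace ℝ E] [FiniteDimensional ℝ E]
  {B : E →ₗ[ℝ] E →ₗ[ℝ] ℂ}

theorem LinearMap.continuous_apply_self_of_finiteDimensional (B : E →ₗ[ℝ] E →ₗ[ℝ] ℂ) :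
    Continuous fun X => B X X := by
  exact B.toContinuousBilinearMap.continuous.clm_apply continuous_id

/-- The real part keeps its sign along a curve of nonzero vectors on which the imaginary part
vanishes. -/
theorem LinearMap.re_apply_self_pos_of_curve (hell : ∀ X, B X X = 0 → X = 0)
    {u : ℝ → E} (hu : Continuous u) (hne : ∀ t, u t ≠ 0) (him : ∀ t, (B (u t) (u t)).im = 0)
    (h0 : 0 < (B (u 0) (u 0)).re) : 0 < (B (u 1) (u 1)).re := by
  by_contra! h1
  have hc : Continuous fun t => (B (u t) (u t)).re :=
    Complex.continuous_re.comp (B.continuous_apply_self_of_finiteDimensional.comp hu)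
  obtain ⟨t, ht⟩ := mem_range_of_exists_le_of_exists_ge hc ⟨1, h1⟩ ⟨0, h0.le⟩
  exact hne t (hell _ (Complex.ext ht (him t)))

/-- In dimension at least three, an elliptic form does not take both values `1` and `-1`. -/
theorem LinearMap.not_opposite_values_of_two_lt_finrank (hB : ∀ X Y, B X Y = B Y X)
    (hell : ∀ X, B X X = 0 → X = 0) (hd : 2 < Module.finrank ℝ E) {X Y : E}
    (hX : B X X = 1) (hY : B Y Y = -1) : False := by
  have hind {x y : ℝ} (h : x • X + y • Y = 0) : x = 0 ∧ y = 0 :=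
    smul_add_smul_eq_zero_of_opposite_values hX hY h
  have hXY : (B X Y).im ≠ 0 := by
    intro hb
    have := re_apply_self_pos_of_curve hell (u := fun t => (1 - t) • X + t • Y) (by fun_prop)
      (fun t ht => by have := hind ht; linarith)
      (fun t => by
        rw [apply_self_smul_add_smul hB, hX, hY]
        simp [hb, pow_two]) (by simp [hX])
    simp [hY] at this
    linarith
  obtain ⟨Z₀, hZ₀⟩ : ∃ Z, Z ∉ Submodule.span ℝ {X, Y} := by
    by_contra! h
    have h1 : Submodule.span ℝ {X, Y} = ⊤ := eq_top_iff.mpr fun Z _ => h Z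
    classical
    have h2 := finrank_span_finset_le_card (R := ℝ) ({X, Y} : Finset E)
    rw [Set.finrank, Finset.coe_pair, h1, finrank_top] at h2
    have h3 : ({X, Y} : Finset E).card ≤ 2 := Finset.card_le_two
    omega
  obtain ⟨Z, hZ, hXZ, hYZ⟩ : ∃ Z, Z ∉ Submodule.span ℝ {X, Y} ∧
      (B X Z).im = 0 ∧ (B Y Z).im = 0 := by
    refine ⟨Z₀ - (((B Y Z₀).im / (B X Y).im) • X + ((B X Z₀).im / (B X Y).im) • Y), ?_, ?_, ?_⟩
    · rwa [Submodule.sub_mem_iff_left _ (Submodule.mem_span_pair.mpr ⟨_, _, rfl⟩)]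
    · simp [hX, hXY]
    · simp [hY, hB Y X, hXY]
  have hind' {x y z : ℝ} (h : x • X + y • Y + z • Z = 0) : x = 0 ∧ y = 0 ∧ z = 0 := by
    have hz : z = 0 := by
      by_contra hz
      refine hZ (Submodule.mem_span_pair.mpr ⟨-(z⁻¹ * x), -(z⁻¹ * y), ?_⟩)
      have h' := congrArg (z⁻¹ • ·) h
      simp only [smul_add, smul_smul, inv_mul_cancel₀ hz, one_smul, smul_zero] at h'
      rw [eq_comm, ← sub_eq_zero, ← h']
      module
    subst hz
    obtain ⟨hx, hy⟩ := hind (by simpa using h)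
    exact ⟨hx, hy, rfl⟩
  have him (x y z : ℝ) : (B (x • X + y • Y + z • Z) (x • X + y • Y + z • Z)).im =
      2 * x * y * (B X Y).im + z ^ 2 * (B Z Z).im := by
    simp only [map_add, map_smul, add_apply, smul_apply, Complex.real_smul, hB Y X, hB Z X, hB Z Y,
      hX, hY]
    simp [hXZ, hYZ]
    ring
  by_cases hc : (B Z Z).im = 0
  · have h1 := re_apply_self_pos_of_curve hell
      (u := fun t => (1 - t) • X + (0 : ℝ) • Y + t • Z) (by fun_prop)
      (fun t ht => by have := hind' ht; linarith)
      (fun t => by rw [him, hc]; ring) (by simp [hX])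
    have h2 := re_apply_self_pos_of_curve hell
      (u := fun t => (0 : ℝ) • X + t • Y + (1 - t) • Z) (by fun_prop)
      (fun t ht => by have := hind' ht; linarith)
      (fun t => by rw [him, hc]; ring) (by simpa using h1)
    simp [hY] at h2
    linarith
  · obtain ⟨ε, k, hε, hk⟩ : ∃ ε k : ℝ, ε ^ 2 = 1 ∧
        2 * ε * (B X Y).im + k ^ 2 * (B Z Z).im = 0 := by
      rcases le_total 0 ((B X Y).im / (B Z Z).im) with h | h
      · refine ⟨-1, Real.sqrt (2 * ((B X Y).im / (B Z Z).im)), by norm_num, ?_⟩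
        rw [Real.sq_sqrt (by linarith)]
        field_simp
        ring
      · refine ⟨1, Real.sqrt (-2 * ((B X Y).im / (B Z Z).im)), by norm_num, ?_⟩
        rw [Real.sq_sqrt (by linarith)]
        field_simp
        ring
    have h := re_apply_self_pos_of_curve hell
      (u := fun t => (1 - t) ^ 2 • X + (ε * t ^ 2) • Y + ((1 - t) * t * k) • Z) (by fun_prop)
      (fun t ht => by
        obtain ⟨h1, h2, -⟩ := hind' ht
        have h3 : t = 1 := by linarith [pow_eq_zero_iff two_ne_zero |>.mp h1]
        rw [h3] at h2
        simp at h2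
        simp [h2] at hε)
      (fun t => by rw [him]; linear_combination (1 - t) ^ 2 * t ^ 2 * hk) (by simp [hX])
    have h4 : ((ε : ℂ) * ε) = 1 := by rw [← pow_two]; exact_mod_cast hε
    simp [hY] at h
    nlinarith

/-- A continuous function without zeros or opposite values on a compact connected space has its
values in an open half-plane. -/
theorem exists_forall_re_mul_pos_of_forall_ne_neg_smul {K : Type*} [TopologicalSpace K]
    [CompactSpace K] [ConnectedSpace K] {f : K → ℂ} (hf : Continuous f)
    (hopp : ∀ x y, ∀ c : ℝ, 0 ≤ c → f x ≠ -(c * f y)) :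
    ∃ z : ℂ, z ≠ 0 ∧ ∀ x, 0 < (z * f x).re := by
  have hne x : f x ≠ 0 := by simpa using hopp x x 0 le_rfl
  obtain ⟨x₀⟩ : Nonempty K := inferInstance
  have hslit x : f x / f x₀ ∈ Complex.slitPlane := by
    rw [Complex.mem_slitPlane_iff_not_le_zero]
    intro h
    obtain ⟨hre, him⟩ := Complex.le_def.mp h
    refine hopp x x₀ (-(f x / f x₀).re) (by simpa using hre) ?_
    have h1 : f x / f x₀ = ((f x / f x₀).re : ℂ) := Complex.ext rfl (by simpa using him)
    rw [Complex.ofReal_neg, ← h1]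
    field_simp [hne x₀]
  set θ : K → ℝ := fun x => (f x / f x₀).arg with hθ
  have hpolar x : f x / f x₀ = ‖f x / f x₀‖ * Complex.exp (θ x * Complex.I) :=
    (Complex.norm_mul_exp_arg_mul_I _).symm
  have hnorm x : 0 < ‖f x / f x₀‖ := norm_pos_iff.mpr (div_ne_zero (hne x) (hne x₀))
  have hθc : Continuous θ := continuous_iff_continuousAt.mpr fun x =>
    (Complex.continuousAt_arg (hslit x)).comp (f := fun x => f x / f x₀)
      (hf.div_const _).continuousAt
  obtain ⟨a, -, ha⟩ := isCompact_univ.exists_isMinOn ⟨x₀, Set.mem_univ _⟩ hθc.continuousOn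
  obtain ⟨b, -, hb⟩ := isCompact_univ.exists_isMaxOn ⟨x₀, Set.mem_univ _⟩ hθc.continuousOn
  replace ha x : θ a ≤ θ x := ha (Set.mem_univ x)
  replace hb x : θ x ≤ θ b := hb (Set.mem_univ x)
  have hlt : θ b - θ a < Real.pi := by
    by_contra! h
    obtain ⟨y, hy⟩ := mem_range_of_exists_le_of_exists_ge hθc (c := θ a + Real.pi)
      ⟨a, by linarith [Real.pi_pos]⟩ ⟨b, by linarith⟩
    refine hopp y a (‖f y / f x₀‖ / ‖f a / f x₀‖) (by positivity) ?_
    have hya := hpolar y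
    have hna : (‖f a / f x₀‖ : ℂ) ≠ 0 := by exact_mod_cast (hnorm a).ne'
    rw [hy, Complex.ofReal_add, add_mul, Complex.exp_add, Complex.exp_pi_mul_I] at hya
    have hexp : Complex.exp (θ a * Complex.I) = f a / f x₀ / ‖f a / f x₀‖ := by
      rw [eq_div_iff hna, mul_comm, ← hpolar a]
    rw [hexp, div_eq_iff (hne x₀)] at hya
    refine hya.trans ?_
    have h0 := hne x₀
    push_cast
    field_simp
  refine ⟨Complex.exp (-((θ a + θ b) / 2 : ℝ) * Complex.I) / f x₀,
    div_ne_zero (Complex.exp_ne_zero _) (hne x₀), fun x => ?_⟩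
  have h1 : Complex.exp (-((θ a + θ b) / 2 : ℝ) * Complex.I) / f x₀ * f x =
      ‖f x / f x₀‖ * Complex.exp ((θ x - (θ a + θ b) / 2 : ℝ) * Complex.I) := by
    rw [div_mul_eq_mul_div, mul_div_assoc, hpolar x, mul_left_comm, ← Complex.exp_add, ← hpolar x]
    congr 2
    push_cast
    ring
  rw [h1, Complex.re_ofReal_mul, Complex.exp_ofReal_mul_I_re]
  refine mul_pos (hnorm x) (Real.cos_pos_of_mem_Ioo ⟨?_, ?_⟩) <;> linarith [ha x, hb x]

/-- A form without opposite values at nonzero vectors has a positive definite rotation. -/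
theorem LinearMap.exists_forall_re_mul_apply_self_pos (hd : 1 < Module.finrank ℝ E)
    (hopp : ∀ X Y, X ≠ 0 → B X X ≠ -B Y Y) :
    ∃ z : ℂ, z ≠ 0 ∧ ∀ X, X ≠ 0 → 0 < (z * B X X).re := by
  have hrank : 1 < Module.rank ℝ E := by
    rw [← Module.finrank_eq_rank]; exact_mod_cast hd
  have : Nontrivial E := Module.nontrivial_of_finrank_pos (R := ℝ) (by omega)
  have : ProperSpace E := FiniteDimensional.proper ℝ E
  have : ConnectedSpace (Metric.sphere (0 : E) 1) :=
    isConnected_iff_connectedSpace.mp (isConnected_sphere hrank 0 zero_le_one)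
  have hne (X : Metric.sphere (0 : E) 1) : (X : E) ≠ 0 := ne_zero_of_mem_unit_sphere X
  obtain ⟨z, hz, hpos⟩ := exists_forall_re_mul_pos_of_forall_ne_neg_smul
    (K := Metric.sphere (0 : E) 1) (f := fun X => B X X)
    (B.continuous_apply_self_of_finiteDimensional.comp continuous_subtype_val)
    (fun X Y c hc h => hopp X (Real.sqrt c • (Y : E)) (hne X) (by
      simpa only [map_smul, smul_apply, Complex.real_smul, ← mul_assoc, ← Complex.ofReal_mul,
        Real.mul_self_sqrt hc] using h))
  refine ⟨z, hz, fun X hX => ?_⟩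
  have hX' : 0 < ‖X‖ := norm_pos_iff.mpr hX
  have h := hpos ⟨‖X‖⁻¹ • X, by simp [norm_smul, hX'.ne']⟩
  simp only [map_smul, smul_apply, Complex.real_smul] at h
  rw [mul_left_comm, mul_left_comm z, Complex.re_ofReal_mul, Complex.re_ofReal_mul] at h
  have hi := inv_pos.mpr hX'
  exact pos_of_mul_pos_right (pos_of_mul_pos_right h hi.le) hi.le

end Normed

/-- if `n ≥ 2`, or `n = 1` and the numerical range of the elliptic
quadratic form `q` is not all of `ℂ`, then there is `z ≠ 0` such that
`X ↦ Re (z * q X)` is positive definite. -/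
theorem exists_positive_definite_rotation {n : ℕ} (hn : 1 ≤ n)
    (q : ((Fin n → ℝ) × (Fin n → ℝ)) → ℂ)
    (hq : IsCQuadForm q)
    (hell : ∀ X, q X = 0 → X = 0)
    (hcase : 2 ≤ n ∨ (n = 1 ∧ Set.range q ≠ Set.univ)) :
    ∃ z : ℂ, z ≠ 0 ∧ ∀ X, X ≠ 0 → 0 < (z * q X).re := by
  obtain ⟨B, hB, hqB⟩ := hq.exists_symm
  obtain rfl : q = fun X => B X X := funext hqB
  have hd : Module.finrank ℝ ((Fin n → ℝ) × (Fin n → ℝ)) = n + n := by simp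
  refine B.exists_forall_re_mul_apply_self_pos (by omega) fun X Y hX h => ?_
  have hw : B X X ≠ 0 := fun h => hX (hell X h)
  have hCB : ∀ V W, ((B X X)⁻¹ • B) V W = ((B X X)⁻¹ • B) W V := fun V W => by simp [hB V W]
  have hCell : ∀ V, ((B X X)⁻¹ • B) V V = 0 → V = 0 := fun V hV =>
    hell V (by simpa [hX, hw] using hV)
  have hCX : ((B X X)⁻¹ • B) X X = 1 := by simp [hw]
  have hCY : ((B X X)⁻¹ • B) Y Y = -1 := by
    rw [← neg_eq_iff_eq_neg] at h
    simp [← h, hw]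
  rcases hcase with hn2 | ⟨-, hrange⟩
  · exact LinearMap.not_opposite_values_of_two_lt_finrank hCB hCell (by omega) hCX hCY
  · refine hrange (Set.eq_univ_of_forall fun w => ?_)
    obtain ⟨V, hV⟩ :=
      LinearMap.surjective_apply_self_of_opposite_values hCB hCell hCX hCY ((B X X)⁻¹ * w)
    exact ⟨V, mul_left_cancel₀ (inv_ne_zero hw) (by simpa using hV)⟩
end

section
/- Let n ≥ 1 and let q : ℝⁿ × ℝⁿ → ℂ be a complex-valued elliptic quadratic form with Σ(q) ≠ ℂ. Then there exist nonzero complex numbers z₁, z₂ such that Σ(q) = {s·z₁ + t·z₂ : s, t ∈ ℝ, s ≥ 0, t ≥ 0}, and there exists a nonzero complex number w such that Re(w·u) > 0 for every u ∈ Σ(q) with u ≠ 0. In particular Σ(q) is a closed convex cone with vertex 0 whose opening is strictly less than π. -/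
namespace IsCQuadForm

section Algebra

variable {E : Type*} [AddCommGroup E] [Module ℝ E] {q : E → ℂ}

theorem map_smul (hq : IsCQuadForm q) (a : ℝ) (X : E) : q (a • X) = (a : ℂ) ^ 2 * q X := by
  obtain ⟨B, hB⟩ := hq
  simp only [hB, _root_.map_smul, LinearMap.smul_apply, Complex.real_smul]
  ring

theorem exists_polar (hq : IsCQuadForm q) (X Y : E) :
    ∃ w : ℂ, ∀ a b : ℝ, q (a • X + b • Y) = a ^ 2 * q X + b ^ 2 * q Y + 2 * a * b * w := by
  obtain ⟨B, hB⟩ := hq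
  refine ⟨(B X Y + B Y X) / 2, fun a b => ?_⟩
  simp only [hB, map_add, _root_.map_smul, LinearMap.smul_apply, LinearMap.add_apply,
    Complex.real_smul]
  ring

/-- An elliptic form that is not onto `ℂ` does not take values in opposite directions. -/
theorem ne_neg_mul (hq : IsCQuadForm q) (hell : ∀ X, q X = 0 → X = 0)
    (hrange : Set.range q ≠ Set.univ) {X Y : E} (hX : X ≠ 0) {c : ℝ} (hc : 0 < c) :
    q Y ≠ -(c * q X) := by
  intro hY
  have hv : q X ≠ 0 := fun h => hX (hell X h)
  obtain ⟨w, hw⟩ := hq.exists_polar X Y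
  obtain ⟨m, rfl⟩ : ∃ m, w = m * q X := ⟨w / q X, by field_simp⟩
  by_cases hm : m.im = 0
  · obtain ⟨k, rfl⟩ : ∃ k : ℝ, m = k := ⟨m.re, Complex.ext rfl (by simpa using hm)⟩
    set a : ℝ := -k + √(k ^ 2 + c) with ha
    have haq : a ^ 2 - c + 2 * a * k = 0 := by
      have := Real.sq_sqrt (show 0 ≤ k ^ 2 + c by positivity)
      rw [ha]
      linear_combination this
    have h0 : a • X + (1 : ℝ) • Y = 0 := by
      apply hell
      have haq' : (a : ℂ) ^ 2 - c + 2 * a * k = 0 := by exact_mod_cast haq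
      rw [hw, hY]
      push_cast
      linear_combination q X * haq'
    have hYX : Y = (-a) • X := by
      rw [one_smul] at h0
      rw [neg_smul]
      exact eq_neg_of_add_eq_zero_right h0
    rw [hYX, hq.map_smul] at hY
    have h1 : (((a ^ 2 + c : ℝ)) : ℂ) * q X = 0 := by
      push_cast at hY ⊢
      linear_combination hY
    rcases mul_eq_zero.1 h1 with h | h
    · have : a ^ 2 + c = 0 := by exact_mod_cast h
      nlinarith [sq_nonneg a]
    · exact hv h
  · refine hrange (Set.eq_univ_of_forall fun τ => ?_)
    set r : ℝ := (τ / q X).im / m.im with hr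
    set p : ℝ := (τ / q X).re - r * m.re with hp
    have hτ : τ / q X = p + r * m := by
      apply Complex.ext
      · simp [hp]
      · simp [hr, hm]
    obtain ⟨z, hz⟩ := IsAlgClosed.exists_pow_nat_eq (⟨p, r * √c⟩ : ℂ) (n := 2) (by norm_num)
    have hre : z.re ^ 2 - z.im ^ 2 = p := by
      have := congrArg Complex.re hz
      simp [sq] at this
      linarith
    have him : 2 * z.re * z.im = r * √c := by
      have := congrArg Complex.im hz
      simp [sq] at this
      linarith
    have hsc : √c ≠ 0 := (Real.sqrt_pos.2 hc).ne'
    refine ⟨z.re • X + (z.im / √c) • Y, ?_⟩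
    have e1 : z.re ^ 2 - c * (z.im / √c) ^ 2 = p := by
      rw [div_pow, Real.sq_sqrt hc.le, ← hre]
      field_simp
    have e2 : 2 * z.re * (z.im / √c) = r := by
      field_simp
      linarith
    have e1' : (z.re : ℂ) ^ 2 - c * ((z.im / √c : ℝ) : ℂ) ^ 2 = p := by exact_mod_cast e1
    have e2' : 2 * (z.re : ℂ) * ((z.im / √c : ℝ) : ℂ) = r := by exact_mod_cast e2
    rw [div_eq_iff hv] at hτ
    rw [hw, hY, hτ]
    linear_combination q X * e1' + m * q X * e2'

end Algebra

variable {E : Type*} [NormedAddCommGroup E] [NormedSpace ℝ E] [FiniteDimensional ℝ E] {q : E → ℂ}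

theorem continuous (hq : IsCQuadForm q) : Continuous q := by
  obtain ⟨B, hB⟩ := hq
  have h : Continuous fun X => LinearMap.toContinuousLinearMap (B X) :=
    LinearMap.continuous_of_finiteDimensional
      ((LinearMap.toContinuousLinearMap : (E →ₗ[ℝ] ℂ) ≃ₗ[ℝ] E →L[ℝ] ℂ).toLinearMap ∘ₗ B)
  rw [show q = fun X => LinearMap.toContinuousLinearMap (B X) X from funext hB]
  exact h.clm_apply continuous_id

/-- A continuous function takes a compact interval of values on the unit sphere. -/
theorem _root_.exists_image_sphere_eq_Icc (hE : 1 < Module.rank ℝ E) {f : E → ℝ}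
    (hf : ContinuousOn f (Metric.sphere 0 1)) :
    ∃ a b : ℝ, a ≤ b ∧ f '' Metric.sphere 0 1 = Set.Icc a b := by
  have := FiniteDimensional.proper_real E
  have hconn := (isConnected_sphere hE (0 : E) zero_le_one).image f hf
  have hcomp := (isCompact_sphere (0 : E) 1).image_of_continuousOn hf
  have heq := eq_Icc_of_connected_compact hconn hcomp
  refine ⟨_, _, ?_, heq⟩
  have := hconn.nonempty
  rw [heq] at this
  exact Set.nonempty_Icc.1 this

theorem exists_re_mul_pos (hq : IsCQuadForm q) (hell : ∀ X, q X = 0 → X = 0)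
    (hrange : Set.range q ≠ Set.univ) (hE : 1 < Module.rank ℝ E) :
    ∃ w : ℂ, w ≠ 0 ∧ ∀ X, X ≠ 0 → 0 < (w * q X).re := by
  obtain ⟨X₀, hX₀⟩ : ∃ X : E, X ≠ 0 :=
    have := (rank_pos_iff_nontrivial (R := ℝ) (M := E)).1 (zero_lt_one.trans hE)
    exists_ne 0
  have hv : q X₀ ≠ 0 := fun h => hX₀ (hell _ h)
  have hne : ∀ X ∈ Metric.sphere (0 : E) 1, X ≠ 0 := fun X hX =>
    ne_zero_of_mem_unit_sphere ⟨X, hX⟩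
  have hcont : ContinuousOn (fun X => (q X / q X₀).arg) (Metric.sphere 0 1) := by
    intro X hX
    refine ContinuousAt.continuousWithinAt ?_
    refine ContinuousAt.comp (g := Complex.arg) (Complex.continuousAt_arg ?_)
      (hq.continuous.div_const _).continuousAt
    rw [Complex.mem_slitPlane_iff_not_le_zero]
    intro hle
    obtain ⟨c, hc, hc'⟩ : ∃ c : ℝ, c ≤ 0 ∧ (c : ℂ) = q X / q X₀ :=
      ⟨_, (Complex.le_def.1 hle).1, Complex.ext rfl (Complex.le_def.1 hle).2.symm⟩
    have hqX : q X = -(((-c : ℝ) : ℂ) * q X₀) := by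
      rw [← div_mul_cancel₀ (q X) hv, ← hc']
      push_cast
      ring
    have hc0 : c ≠ 0 := by
      rintro rfl
      exact hne X hX (hell X (by simpa using hqX))
    exact hq.ne_neg_mul hell hrange hX₀ (neg_pos.2 (lt_of_le_of_ne hc hc0)) hqX
  obtain ⟨α, β, hαβ, him⟩ := exists_image_sphere_eq_Icc hE hcont
  have polar : ∀ X, q X = ‖q X / q X₀‖ * Complex.exp ((q X / q X₀).arg * Complex.I) * q X₀ := by
    intro X
    rw [Complex.norm_mul_exp_arg_mul_I, div_mul_cancel₀ _ hv]
  have hpos : ∀ X ∈ Metric.sphere (0 : E) 1, 0 < ‖q X / q X₀‖ := fun X hX =>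
    norm_pos_iff.2 (div_ne_zero (fun h => hne X hX (hell X h)) hv)
  have hlt : β - α < Real.pi := by
    by_contra! hcon
    obtain ⟨X, hX, hXβ⟩ : β ∈ (fun X => (q X / q X₀).arg) '' Metric.sphere 0 1 := by
      rw [him]; exact ⟨hαβ, le_rfl⟩
    obtain ⟨Y, hY, hYβ⟩ : β - Real.pi ∈ (fun X => (q X / q X₀).arg) '' Metric.sphere 0 1 := by
      rw [him]; exact ⟨by linarith, by linarith [Real.pi_pos]⟩
    refine hq.ne_neg_mul hell hrange (hne X hX) (Y := Y) (div_pos (hpos Y hY) (hpos X hX)) ?_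
    have h1 := polar X
    have h2 := polar Y
    dsimp only at hXβ hYβ
    rw [hXβ] at h1
    rw [hYβ, Complex.ofReal_sub, sub_mul, Complex.exp_sub, Complex.exp_pi_mul_I] at h2
    have hX' : ((‖q X / q X₀‖ : ℝ) : ℂ) ≠ 0 := by exact_mod_cast (hpos X hX).ne'
    generalize ‖q X / q X₀‖ = r at *
    generalize ‖q Y / q X₀‖ = r' at *
    rw [h1, h2]
    push_cast
    field_simp
  refine ⟨Complex.exp (((-((α + β) / 2) : ℝ) : ℂ) * Complex.I) / q X₀,
    div_ne_zero (Complex.exp_ne_zero _) hv, ?_⟩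
  have key : ∀ X ∈ Metric.sphere (0 : E) 1,
      0 < (Complex.exp (((-((α + β) / 2) : ℝ) : ℂ) * Complex.I) / q X₀ * q X).re := by
    intro X hX
    have hmem : (q X / q X₀).arg ∈ Set.Icc α β := him ▸ ⟨X, hX, rfl⟩
    have h : Complex.exp (((-((α + β) / 2) : ℝ) : ℂ) * Complex.I) / q X₀ * q X =
        (‖q X / q X₀‖ : ℝ) *
          Complex.exp (((-((α + β) / 2) + (q X / q X₀).arg : ℝ) : ℂ) * Complex.I) := by
      rw [Complex.ofReal_add, add_mul, Complex.exp_add, mul_left_comm,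
        Complex.norm_mul_exp_arg_mul_I]
      ring
    rw [h, Complex.re_ofReal_mul, Complex.exp_ofReal_mul_I_re]
    refine mul_pos (hpos X hX) (Real.cos_pos_of_mem_Ioo ⟨?_, ?_⟩) <;>
      linarith [hmem.1, hmem.2]
  intro X hX
  have hs := key (‖X‖⁻¹ • X) (by simp [norm_smul, hX])
  rw [hq.map_smul, mul_left_comm, ← Complex.ofReal_pow, Complex.re_ofReal_mul] at hs
  exact pos_of_mul_pos_right hs (by positivity)

end IsCQuadForm

/-- the numerical range of an elliptic quadratic form with
`Σ(q) ≠ ℂ` is a closed angular sector with vertex `0` and opening strictly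
less than `π`: it is the convex cone spanned by two nonzero complex numbers
`z₁, z₂`, and there is `w ≠ 0` with `Re (w * u) > 0` for every nonzero
`u ∈ Σ(q)`. -/
theorem numericalRange_eq_sector {n : ℕ} (hn : 1 ≤ n)
    (q : ((Fin n → ℝ) × (Fin n → ℝ)) → ℂ)
    (hq : IsCQuadForm q)
    (hell : ∀ X, q X = 0 → X = 0)
    (hrange : Set.range q ≠ Set.univ) :
    ∃ z₁ z₂ : ℂ, z₁ ≠ 0 ∧ z₂ ≠ 0 ∧
      Set.range q = {u : ℂ | ∃ s t : ℝ, 0 ≤ s ∧ 0 ≤ t ∧ u = s • z₁ + t • z₂} ∧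
      ∃ w : ℂ, w ≠ 0 ∧ ∀ u ∈ Set.range q, u ≠ 0 → 0 < (w * u).re := by
  have hE : 1 < Module.rank ℝ ((Fin n → ℝ) × (Fin n → ℝ)) := by
    rw [← Module.finrank_eq_rank]
    have : 1 < Module.finrank ℝ ((Fin n → ℝ) × (Fin n → ℝ)) := by
      simp
      omega
    exact_mod_cast this
  obtain ⟨w, hw, hpos⟩ := hq.exists_re_mul_pos hell hrange hE
  have hne : ∀ X ∈ Metric.sphere (0 : (Fin n → ℝ) × (Fin n → ℝ)) 1, X ≠ 0 := fun X hX =>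
    ne_zero_of_mem_unit_sphere ⟨X, hX⟩
  have hq0 : q 0 = 0 := by simpa using hq.map_smul 0 0
  have hcw : Continuous fun X => w * q X := continuous_const.mul hq.continuous
  obtain ⟨a, b, hab, him⟩ := exists_image_sphere_eq_Icc hE
    (f := fun X => (w * q X).im / (w * q X).re)
    ((Complex.continuous_im.comp hcw).continuousOn.div (Complex.continuous_re.comp hcw).continuousOn
      fun X hX => (hpos X (hne X hX)).ne')
  have hslope : ∀ m : ℝ, (⟨1, m⟩ : ℂ) ≠ 0 := fun m h => one_ne_zero (congrArg Complex.re h)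
  refine ⟨⟨1, a⟩ / w, ⟨1, b⟩ / w, div_ne_zero (hslope a) hw, div_ne_zero (hslope b) hw, ?_, w, hw, ?_⟩
  · have hcomb : ∀ (u : ℂ) (s t : ℝ), u = s • ((⟨1, a⟩ : ℂ) / w) + t • ((⟨1, b⟩ : ℂ) / w) ↔
        (w * u).re = s + t ∧ (w * u).im = s * a + t * b := by
      intro u s t
      have : u = s • ((⟨1, a⟩ : ℂ) / w) + t • ((⟨1, b⟩ : ℂ) / w) ↔
          w * u = s * (⟨1, a⟩ : ℂ) + t * (⟨1, b⟩ : ℂ) := by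
        rw [Complex.real_smul, Complex.real_smul, ← mul_div_assoc, ← mul_div_assoc, ← add_div,
          eq_div_iff hw, mul_comm u]
      rw [this, Complex.ext_iff]
      simp
    ext u
    simp only [Set.mem_ofPred_eq, hcomb]
    constructor
    · rintro ⟨X, rfl⟩
      rcases eq_or_ne X 0 with rfl | hX
      · exact ⟨0, 0, le_rfl, le_rfl, by simp [hq0]⟩
      have hx := hpos X hX
      have hmem : (w * q X).im / (w * q X).re ∈ Set.Icc a b := by
        rw [← him]
        refine ⟨‖X‖⁻¹ • X, by simp [norm_smul, hX], ?_⟩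
        have hn : (‖X‖⁻¹) ^ 2 ≠ 0 := by simp [hX]
        simp only [hq.map_smul, mul_left_comm w, ← Complex.ofReal_pow, Complex.re_ofReal_mul,
          Complex.im_ofReal_mul]
        exact mul_div_mul_left _ _ hn
      obtain ⟨s, t, hs, ht, hst, h⟩ := Convex.mem_Icc hab |>.1 hmem
      refine ⟨(w * q X).re * s, (w * q X).re * t, by positivity, by positivity, ?_, ?_⟩
      · rw [← mul_add, hst, mul_one]
      · rw [eq_div_iff hx.ne'] at h
        linear_combination -h
    · rintro ⟨s, t, hs, ht, hre, him'⟩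
      rcases (add_nonneg hs ht).eq_or_lt with h0 | hst
      · obtain rfl : s = 0 := by linarith
        obtain rfl : t = 0 := by linarith
        have : w * u = 0 := Complex.ext (by simpa using hre) (by simpa using him')
        exact ⟨0, by rw [hq0, (mul_eq_zero.1 this).resolve_left hw]⟩
      have hmem : (s * a + t * b) / (s + t) ∈ Set.Icc a b := by
        constructor
        · rw [le_div_iff₀ hst]; nlinarith
        · rw [div_le_iff₀ hst]; nlinarith
      rw [← him] at hmem
      obtain ⟨X, hX, hXm⟩ := hmem
      have hx := hpos X (hne X hX)
      dsimp only at hXm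
      refine ⟨√((s + t) / (w * q X).re) • X, mul_left_cancel₀ hw ?_⟩
      rw [hq.map_smul, mul_left_comm, ← Complex.ofReal_pow, Real.sq_sqrt (by positivity)]
      apply Complex.ext
      · rw [Complex.re_ofReal_mul, hre, div_mul_cancel₀ _ hx.ne']
      · rw [Complex.im_ofReal_mul, him', div_mul_eq_mul_div, mul_div_assoc, hXm,
          mul_div_cancel₀ _ hst.ne']
  · rintro _ ⟨X, rfl⟩ hu
    exact hpos X fun h => hu (h ▸ hq0)
end

section
/- Let n ≥ 1 and let q : ℝⁿ × ℝⁿ → ℂ be a complex-valued elliptic quadratic form with Σ(q) ≠ ℂ. If z belongs to the topological boundary ∂Σ(q) of the numerical range Σ(q) in ℂ, then every point (x₀, ξ₀) ∈ ℝ^{2n} with q(x₀, ξ₀) = z satisfies {Re q, Im q}(x₀, ξ₀) = 0. -/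
/-- The Poisson bracket `{f, g} = ∑ⱼ (∂f/∂ξⱼ ∂g/∂xⱼ − ∂f/∂xⱼ ∂g/∂ξⱼ)` of two
functions on `ℝⁿ_x × ℝⁿ_ξ`, expressed via Fréchet derivatives. -/
noncomputable def poissonBracket {n : ℕ}
    (f g : ((Fin n → ℝ) × (Fin n → ℝ)) → ℝ)
    (p : (Fin n → ℝ) × (Fin n → ℝ)) : ℝ :=
  ∑ j : Fin n,
    (fderiv ℝ f p (0, Pi.single j 1) * fderiv ℝ g p (Pi.single j 1, 0)
      - fderiv ℝ f p (Pi.single j 1, 0) * fderiv ℝ g p (0, Pi.single j 1))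

/-- A complex-valued quadratic form on a finite-dimensional normed space is continuously
differentiable. -/
theorem IsCQuadForm.contDiff {E : Type*} [NormedAddCommGroup E] [NormedSpace ℝ E]
    [FiniteDimensional ℝ E] {q : E → ℂ} (hq : IsCQuadForm q) : ContDiff ℝ 1 q := by
  obtain ⟨B, hB⟩ := hq
  have hC : q = fun X => B.toContinuousBilinearMap X X := funext hB
  rw [hC]
  exact B.toContinuousBilinearMap.contDiff.clm_apply contDiff_id

/-- A real-linear map to `ℂ` whose values include two real-linearly independent numbers is
surjective. -/
theorem surjective_of_re_mul_im_sub_ne_zero {E : Type*} [AddCommGroup E] [Module ℝ E]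
    (L : E →ₗ[ℝ] ℂ) {u v : E} (h : (L u).re * (L v).im - (L v).re * (L u).im ≠ 0) :
    Function.Surjective L := by
  intro w
  set d := (L u).re * (L v).im - (L v).re * (L u).im with hd
  refine ⟨((w.re * (L v).im - w.im * (L v).re) / d) • u +
    ((w.im * (L u).re - w.re * (L u).im) / d) • v, ?_⟩
  apply Complex.ext
  · simp only [map_add, map_smul, Complex.add_re, Complex.smul_re, smul_eq_mul]
    field_simp
    rw [hd]
    ring
  · simp only [map_add, map_smul, Complex.add_im, Complex.smul_im, smul_eq_mul]
    field_simp
    rw [hd]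
    ring

/-- on the boundary of the numerical range of an elliptic
quadratic form with `Σ(q) ≠ ℂ`, the Poisson bracket `{Re q, Im q}` vanishes at
every point where the value `z` is attained. -/
theorem poissonBracket_eq_zero_on_boundary {n : ℕ} (hn : 1 ≤ n)
    (q : ((Fin n → ℝ) × (Fin n → ℝ)) → ℂ)
    (hq : IsCQuadForm q)
    (hell : ∀ X, q X = 0 → X = 0)
    (hrange : Set.range q ≠ Set.univ)
    (z : ℂ) (hz : z ∈ frontier (Set.range q))
    (X₀ : (Fin n → ℝ) × (Fin n → ℝ)) (hX₀ : q X₀ = z) :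
    poissonBracket (fun X => (q X).re) (fun X => (q X).im) X₀ = 0 := by
  have hL : HasStrictFDerivAt q (fderiv ℝ q X₀) X₀ :=
    hq.contDiff.contDiffAt.hasStrictFDerivAt one_ne_zero
  have hns : ¬ Function.Surjective (fderiv ℝ q X₀) := fun hs => hz.2 <| by
    rw [mem_interior_iff_mem_nhds, ← hX₀,
      ← hL.map_nhds_eq_of_surj (LinearMap.range_eq_top.2 hs)]
    exact Filter.range_mem_map
  have hre : fderiv ℝ (fun X => (q X).re) X₀ = Complex.reCLM.comp (fderiv ℝ q X₀) :=
    (Complex.reCLM.hasFDerivAt.comp X₀ hL.hasFDerivAt).fderiv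
  have him : fderiv ℝ (fun X => (q X).im) X₀ = Complex.imCLM.comp (fderiv ℝ q X₀) :=
    (Complex.imCLM.hasFDerivAt.comp X₀ hL.hasFDerivAt).fderiv
  refine Finset.sum_eq_zero fun j _ => ?_
  by_contra hne
  rw [hre, him] at hne
  exact hns (surjective_of_re_mul_im_sub_ne_zero (fderiv ℝ q X₀).toLinearMap hne)
end

section
/- Let n ≥ 1 and let q : ℝⁿ × ℝⁿ → ℂ be a complex-valued elliptic quadratic form with Σ(q) ≠ ℂ, and assume that the quadratic form {Re q, Im q} is not identically zero. Then for every z in the topological interior of Σ(q) there exists a point (x₀, ξ₀) ∈ ℝ^{2n} such that q(x₀, ξ₀) = z and {Re q, Im q}(x₀, ξ₀) ≠ 0. Equivalently, the set of z ∈ Σ(q) such that every solution of q(x, ξ) = z satisfies {Re q, Im q}(x, ξ) = 0 is exactly the boundary ∂Σ(q). -/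
open Filter Topology

/-- `f` restricted to every affine line is a polynomial of degree at most two whose extreme
coefficients are values of `f`. -/
def QuadraticOnLines {E : Type*} [AddCommGroup E] [Module ℝ E] (f : E → ℝ) : Prop :=
  ∀ X Y, ∃ m : ℝ, ∀ t : ℝ, f (X + t • Y) = f X + t * m + t ^ 2 * f Y

section QuadraticOnLines

variable {E : Type*} [AddCommGroup E] [Module ℝ E] {p R : E → ℝ}

lemma QuadraticOnLines.eq_zero_of_neg (hp : QuadraticOnLines p) (hR : QuadraticOnLines R)
    (hpR : ∀ X, R X = 0 → p X = 0) {X Y : E} (hX : 0 < R X) (hpX : p X = 0) (hY : R Y < 0) :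
    p Y = 0 := by
  obtain ⟨m, hm⟩ := hR X Y
  obtain ⟨k, hk⟩ := hp X Y
  set D := m ^ 2 - 4 * R X * R Y with hD
  have hDpos : 0 < D := by nlinarith [mul_pos hX (neg_pos.2 hY), sq_nonneg m]
  have hs : √D ^ 2 = D := Real.sq_sqrt hDpos.le
  have hs0 : 0 < √D := Real.sqrt_pos.2 hDpos
  have key : ∀ s : ℝ, s ^ 2 = D → k + (-m + s) / (2 * R Y) * p Y = 0 := by
    intro s hs
    set t := (-m + s) / (2 * R Y) with ht
    have hts : 2 * R Y * t = -m + s := by rw [ht, mul_div_cancel₀ _ (by linarith)]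
    have hroot : R X + t * m + t ^ 2 * R Y = 0 := by
      have h4 : 4 * R Y * (R X + t * m + t ^ 2 * R Y) = 0 := by
        linear_combination (2 * R Y * t + m + s) * hts + hs + hD
      exact (mul_eq_zero.1 h4).resolve_left (by linarith)
    have hpt := hpR _ ((hm t).trans hroot)
    have ht0 : t ≠ 0 := by
      intro h
      rw [h] at hroot
      linarith
    rw [hk, hpX] at hpt
    exact (mul_eq_zero.1 (show t * (k + t * p Y) = 0 by linear_combination hpt)).resolve_left ht0
  have h₁ := key _ hs
  have h₂ := key (-√D) (by rw [neg_sq, hs])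
  have h : √D / R Y * p Y = 0 := by
    have : √D / R Y = (-m + √D) / (2 * R Y) - (-m + -√D) / (2 * R Y) := by
      field_simp; ring
    rw [this]; linear_combination h₁ - h₂
  exact (mul_eq_zero.1 h).resolve_left (div_ne_zero hs0.ne' hY.ne)

/-- A quadratic function vanishing on the null cone of an indefinite quadratic function `R`, and
at one point where `R` is positive, vanishes identically. -/
lemma QuadraticOnLines.eq_zero_of_null_cone (hp : QuadraticOnLines p) (hR : QuadraticOnLines R)
    (hpR : ∀ X, R X = 0 → p X = 0) {X Y : E} (hX : 0 < R X) (hpX : p X = 0) (hY : R Y < 0)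
    (Z : E) : p Z = 0 := by
  have hneg : ∀ W, R W < 0 → p W = 0 := fun W ↦ hp.eq_zero_of_neg hR hpR hX hpX
  obtain ⟨m, hm⟩ := hR Y Z
  obtain ⟨k, hk⟩ := hp Y Z
  have hcont : Continuous fun t : ℝ ↦ R Y + t * m + t ^ 2 * R Z := by fun_prop
  have hev : ∀ᶠ t : ℝ in 𝓝 0, R Y + t * m + t ^ 2 * R Z < 0 :=
    hcont.continuousAt.eventually_lt_const (by simpa using hY)
  obtain ⟨δ, hδ, h⟩ := Metric.eventually_nhds_iff.1 hev
  have hzero : ∀ t : ℝ, |t| < δ → t * k + t ^ 2 * p Z = 0 := by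
    intro t ht
    have h₁ := hneg (Y + t • Z) (by rw [hm]; exact h (by simpa using ht))
    rw [hk, hneg Y hY] at h₁
    linarith
  have h₁ := hzero (δ / 2) (by rw [abs_of_pos] <;> linarith)
  have h₂ := hzero (-(δ / 2)) (by rw [abs_neg, abs_of_pos] <;> linarith)
  have h₃ : (δ / 2) ^ 2 * p Z = 0 := by linarith
  exact (mul_eq_zero.1 h₃).resolve_left (by positivity)

end QuadraticOnLines

section Antipodal

variable {E : Type*} [AddCommGroup E] [Module ℝ E]

lemma apply_lin_comb (B : E →ₗ[ℝ] E →ₗ[ℝ] ℂ) (s t : ℝ) (X Y : E) :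
    B (s • X + t • Y) (s • X + t • Y) =
      s ^ 2 * B X X + s * t * (B X Y + B Y X) + t ^ 2 * B Y Y := by
  simp only [map_add, map_smul, LinearMap.add_apply, LinearMap.smul_apply, Complex.real_smul]
  ring

/-- An elliptic quadratic form taking two opposite nonzero values is surjective. -/
lemma surjective_of_antipodal (B : E →ₗ[ℝ] E →ₗ[ℝ] ℂ) (hell : ∀ X, B X X = 0 → X = 0)
    {z : ℂ} (hz : z ≠ 0) {X Y : E} (hX : B X X = z) (hY : B Y Y = -z) (w : ℂ) :
    ∃ Z, B Z Z = w := by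
  set a := ((B X Y + B Y X) / z).re with ha
  set b := ((B X Y + B Y X) / z).im with hb
  have hab : B X Y + B Y X = z * (a + b * Complex.I) := by
    rw [ha, hb, Complex.re_add_im]; field_simp
  have hlin : ∀ s t : ℝ, B (s • X + t • Y) (s • X + t • Y) =
      z * (((s ^ 2 - t ^ 2 + a * (s * t) : ℝ) : ℂ) + ((b * (s * t) : ℝ) : ℂ) * Complex.I) := by
    intro s t
    rw [apply_lin_comb, hab, hX, hY]
    push_cast
    ring
  have hb0 : b ≠ 0 := by
    intro hb0
    set s := (-a + √(a ^ 2 + 4)) / 2 with hs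
    have hsq : √(a ^ 2 + 4) ^ 2 = a ^ 2 + 4 := Real.sq_sqrt (by positivity)
    have hroot : s ^ 2 - 1 ^ 2 + a * (s * 1) = 0 := by
      rw [hs]; linear_combination hsq / 4
    have hzero := hlin s 1
    rw [hroot, hb0] at hzero
    have hYX : Y = (-s) • X := by
      have := hell _ (hzero.trans (by simp))
      rw [neg_smul]
      exact eq_neg_of_add_eq_zero_right (by simpa using this)
    have hYY : B Y Y = s ^ 2 * z := by
      rw [hYX]
      simp only [map_smul, LinearMap.smul_apply, Complex.real_smul, hX]
      push_cast; ring
    have h1 : ((s ^ 2 + 1 : ℝ) : ℂ) * z = 0 := by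
      push_cast; linear_combination hY - hYY
    rcases mul_eq_zero.1 h1 with h | h
    · have : s ^ 2 + 1 = 0 := by exact_mod_cast h
      linarith [sq_nonneg s]
    · exact hz h
  set u := (w / z).re with hu
  set v := (w / z).im with hv
  obtain ⟨c, hc⟩ := IsAlgClosed.exists_pow_nat_eq (⟨u - a * (v / b), 2 * (v / b)⟩ : ℂ) two_pos
  have hre := congrArg Complex.re hc
  have him := congrArg Complex.im hc
  simp only [pow_two, Complex.mul_re, Complex.mul_im] at hre him
  refine ⟨c.re • X + c.im • Y, ?_⟩
  have h2 : c.re * c.im = v / b := by linarith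
  rw [hlin, h2, show c.re ^ 2 - c.im ^ 2 + a * (v / b) = u by linarith,
    mul_div_cancel₀ v hb0, hu, hv, Complex.re_add_im]
  field_simp

end Antipodal

section FiniteDimensional

variable {E : Type*} [NormedAddCommGroup E] [NormedSpace ℝ E] [FiniteDimensional ℝ E]

lemma hasStrictFDerivAt_diagonal (B : E →ₗ[ℝ] E →ₗ[ℝ] ℂ) (X : E) :
    ∃ L : E →L[ℝ] ℂ, HasStrictFDerivAt (fun X ↦ B X X) L X ∧ ∀ V, L V = B X V + B V X := by
  have h := HasStrictFDerivAt.comp (f := fun X : E ↦ (X, X)) X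
    (B.toContinuousBilinearMap.isBoundedBilinearMap.hasStrictFDerivAt (X, X))
    ((hasStrictFDerivAt_id X).prodMk (hasStrictFDerivAt_id X))
  exact ⟨_, h, fun V ↦ by simp⟩

lemma isClosed_range_of_elliptic (B : E →ₗ[ℝ] E →ₗ[ℝ] ℂ) (hell : ∀ X, B X X = 0 → X = 0) :
    IsClosed (Set.range fun X ↦ B X X) := by
  have hcont : Continuous fun X ↦ B X X := continuous_iff_continuousAt.2 fun X ↦
    (hasStrictFDerivAt_diagonal B X).choose_spec.1.continuousAt
  have : ProperSpace E := FiniteDimensional.proper ℝ E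
  obtain ⟨c, hc, hbound⟩ : ∃ c > 0, ∀ X, c * ‖X‖ ^ 2 ≤ ‖B X X‖ := by
    rcases (Metric.sphere (0 : E) 1).eq_empty_or_nonempty with he | hne
    · refine ⟨1, one_pos, fun X ↦ ?_⟩
      have hX : X = 0 := by
        by_contra hX
        exact (he ▸ (by simp [norm_smul, hX] : ‖X‖⁻¹ • X ∈ Metric.sphere (0 : E) 1) :
          _ ∈ (∅ : Set E))
      simp [hX]
    · obtain ⟨X₀, hX₀, hmin⟩ :=
        (isCompact_sphere (0 : E) 1).exists_isMinOn hne hcont.norm.continuousOn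
      refine ⟨‖B X₀ X₀‖, norm_pos_iff.2 fun h ↦ ?_, fun X ↦ ?_⟩
      · simp [hell _ h] at hX₀
      · rcases eq_or_ne X 0 with rfl | hX
        · simp
        · have h := hmin (by simp [norm_smul, hX] : ‖X‖⁻¹ • X ∈ Metric.sphere (0 : E) 1)
          have hpos : 0 < ‖X‖ := norm_pos_iff.2 hX
          simp only [Set.mem_ofPred_eq, map_smul, LinearMap.smul_apply, norm_smul, norm_inv,
            norm_norm] at h
          calc _ ≤ (‖X‖⁻¹ * (‖X‖⁻¹ * ‖B X X‖)) * ‖X‖ ^ 2 := by gcongr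
            _ = _ := by field_simp
  refine (isProperMap_iff_tendsto_cocompact.2 ⟨hcont, ?_⟩).isClosedMap.isClosed_range
  rw [← Metric.cobounded_eq_cocompact (α := ℂ), ← tendsto_norm_atTop_iff_cobounded]
  refine tendsto_atTop_mono hbound ?_
  exact Tendsto.const_mul_atTop hc
    ((tendsto_pow_atTop two_ne_zero).comp (tendsto_norm_cocompact_atTop (E := E)))

end FiniteDimensional

lemma exists_frontier_of_interior {S : Set ℂ} (hS : IsClosed S) {z : ℂ} (hz0 : z ≠ 0)
    (hz : z ∈ interior S) (hz' : -z ∉ S) :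
    (∃ w ∈ frontier S, 0 < (w / z).im) ∧ ∃ w ∈ S, (w / z).im < 0 := by
  have hc₁ : Continuous fun ε : ℝ ↦ z * (1 + ε * Complex.I) := by fun_prop
  have hc₂ : Continuous fun ε : ℝ ↦ z * (-1 + ε * Complex.I) := by fun_prop
  have he₁ : ∀ᶠ ε : ℝ in 𝓝 0, z * (1 + ε * Complex.I) ∈ interior S :=
    hc₁.continuousAt.eventually_mem (isOpen_interior.mem_nhds (by simpa using hz))
  have he₂ : ∀ᶠ ε : ℝ in 𝓝 0, z * (-1 + ε * Complex.I) ∈ Sᶜ :=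
    hc₂.continuousAt.eventually_mem (hS.isOpen_compl.mem_nhds (by simpa using hz'))
  obtain ⟨δ, hδ, h⟩ := Metric.eventually_nhds_iff.1 (he₁.and he₂)
  have hpos := h (y := δ / 2) (by simp [abs_of_pos hδ, hδ])
  have hneg := h (y := -(δ / 2)) (by simp [abs_of_pos hδ, hδ])
  refine ⟨?_, _, interior_subset hneg.1, ?_⟩
  · by_contra! hcon
    have hconn := (convex_segment (𝕜 := ℝ) (z * (1 + (δ / 2 : ℝ) * Complex.I))
      (z * (-1 + (δ / 2 : ℝ) * Complex.I))).isPreconnected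
    have hcover : segment ℝ (z * (1 + (δ / 2 : ℝ) * Complex.I))
        (z * (-1 + (δ / 2 : ℝ) * Complex.I)) ⊆ interior S ∪ Sᶜ := by
      rintro w ⟨s, t, -, -, hst, rfl⟩
      by_contra hw
      rw [Set.mem_union, not_or, Set.notMem_compl_iff] at hw
      refine (hcon _ (hS.frontier_eq.ge ⟨hw.2, hw.1⟩)).not_gt ?_
      have : (s • (z * (1 + (δ / 2 : ℝ) * Complex.I)) +
          t • (z * (-1 + (δ / 2 : ℝ) * Complex.I))) / z =
          ((s - t : ℝ) : ℂ) + (((s + t) * (δ / 2) : ℝ) : ℂ) * Complex.I := by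
        simp only [Complex.real_smul]
        field_simp
        push_cast
        ring
      rw [this, hst]
      simp [hδ]
    obtain ⟨x, -, hx₁, hx₂⟩ := hconn (interior S) Sᶜ isOpen_interior hS.isOpen_compl hcover
      ⟨_, left_mem_segment _ _ _, hpos.1⟩ ⟨_, right_mem_segment _ _ _, hpos.2⟩
    exact hx₂ (interior_subset hx₁)
  · rw [mul_div_cancel_left₀ _ hz0]
    simp [hδ]

section PoissonBracket

variable {n : ℕ} (B : ((Fin n → ℝ) × (Fin n → ℝ)) →ₗ[ℝ] ((Fin n → ℝ) × (Fin n → ℝ)) →ₗ[ℝ] ℂ)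

lemma poissonBracket_eq_sum {q : (Fin n → ℝ) × (Fin n → ℝ) → ℂ}
    {X : (Fin n → ℝ) × (Fin n → ℝ)} {L : (Fin n → ℝ) × (Fin n → ℝ) →L[ℝ] ℂ}
    (hL : HasFDerivAt q L X) :
    poissonBracket (fun X ↦ (q X).re) (fun X ↦ (q X).im) X =
      ∑ j : Fin n, ((L (0, Pi.single j 1)).re * (L (Pi.single j 1, 0)).im
        - (L (Pi.single j 1, 0)).re * (L (0, Pi.single j 1)).im) := by
  have h₁ : HasFDerivAt (fun X ↦ (q X).re) (Complex.reCLM.comp L) X :=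
    Complex.reCLM.hasFDerivAt.comp X hL
  have h₂ : HasFDerivAt (fun X ↦ (q X).im) (Complex.imCLM.comp L) X :=
    Complex.imCLM.hasFDerivAt.comp X hL
  simp [poissonBracket, h₁.fderiv, h₂.fderiv]

lemma poissonBracket_diagonal (X : (Fin n → ℝ) × (Fin n → ℝ)) :
    poissonBracket (fun X ↦ (B X X).re) (fun X ↦ (B X X).im) X =
      ∑ j : Fin n,
        ((B X (0, Pi.single j 1) + B (0, Pi.single j 1) X).re *
            (B X (Pi.single j 1, 0) + B (Pi.single j 1, 0) X).im
          - (B X (Pi.single j 1, 0) + B (Pi.single j 1, 0) X).re *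
            (B X (0, Pi.single j 1) + B (0, Pi.single j 1) X).im) := by
  obtain ⟨L, hL, hLB⟩ := hasStrictFDerivAt_diagonal B X
  simp only [poissonBracket_eq_sum hL.hasFDerivAt, hLB]

lemma quadraticOnLines_poissonBracket :
    QuadraticOnLines (poissonBracket (fun X ↦ (B X X).re) (fun X ↦ (B X X).im)) := by
  intro X Y
  let D (X V : (Fin n → ℝ) × (Fin n → ℝ)) : ℂ := B X V + B V X
  let c (X Y : (Fin n → ℝ) × (Fin n → ℝ)) (j : Fin n) : ℝ :=
    (D X (0, Pi.single j 1)).re * (D Y (Pi.single j 1, 0)).im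
      - (D X (Pi.single j 1, 0)).re * (D Y (0, Pi.single j 1)).im
  refine ⟨∑ j, (c X Y j + c Y X j), fun t ↦ ?_⟩
  simp only [poissonBracket_diagonal, Finset.mul_sum, ← Finset.sum_add_distrib]
  refine Finset.sum_congr rfl fun j _ ↦ ?_
  simp only [c, D, map_add, map_smul, LinearMap.add_apply, LinearMap.smul_apply, Complex.add_re,
    Complex.add_im, Complex.smul_re, Complex.smul_im, smul_eq_mul]
  ring

lemma quadraticOnLines_im_div (z : ℂ) : QuadraticOnLines fun X ↦ (B X X / z).im := by
  intro X Y
  refine ⟨((B X Y + B Y X) / z).im, fun t ↦ ?_⟩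
  have h : B (X + t • Y) (X + t • Y) / z =
      B X X / z + t • ((B X Y + B Y X) / z) + (t ^ 2) • (B Y Y / z) := by
    have := apply_lin_comb B 1 t X Y
    rw [one_smul] at this
    rw [this]
    simp only [Complex.real_smul]
    push_cast
    ring
  simp only [h, Complex.add_im, Complex.smul_im, smul_eq_mul]

lemma surjective_of_det_ne_zero {E : Type*} [AddCommGroup E] [Module ℝ E] (L : E →ₗ[ℝ] ℂ)
    {U V : E}
    (h : (L U).re * (L V).im - (L V).re * (L U).im ≠ 0) : Function.Surjective L := by
  intro w
  set d := (L U).re * (L V).im - (L V).re * (L U).im with hd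
  refine ⟨((w.re * (L V).im - (L V).re * w.im) / d) • U +
    (((L U).re * w.im - w.re * (L U).im) / d) • V, ?_⟩
  apply Complex.ext <;>
  · simp only [map_add, map_smul, Complex.add_re, Complex.add_im, Complex.smul_re,
      Complex.smul_im, smul_eq_mul]
    field_simp
    rw [hd]
    ring

lemma mem_interior_range_of_poissonBracket_ne_zero {X : (Fin n → ℝ) × (Fin n → ℝ)}
    (hX : poissonBracket (fun X ↦ (B X X).re) (fun X ↦ (B X X).im) X ≠ 0) :
    B X X ∈ interior (Set.range fun X ↦ B X X) := by
  obtain ⟨L, hL, -⟩ := hasStrictFDerivAt_diagonal B X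
  rw [poissonBracket_eq_sum hL.hasFDerivAt] at hX
  obtain ⟨j, -, hj⟩ := Finset.exists_ne_zero_of_sum_ne_zero hX
  have hsurj : Function.Surjective L := surjective_of_det_ne_zero L.toLinearMap hj
  rw [mem_interior_iff_mem_nhds,
    ← hL.map_nhds_eq_of_surj (LinearMap.range_eq_top.2 hsurj)]
  exact range_mem_map

lemma poissonBracket_smul (s : ℝ) (X : (Fin n → ℝ) × (Fin n → ℝ)) :
    poissonBracket (fun X ↦ (B X X).re) (fun X ↦ (B X X).im) (s • X) =
      s ^ 2 * poissonBracket (fun X ↦ (B X X).re) (fun X ↦ (B X X).im) X := by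
  simp only [poissonBracket_diagonal, Finset.mul_sum]
  refine Finset.sum_congr rfl fun j _ ↦ ?_
  simp only [map_smul, LinearMap.smul_apply, Complex.add_re, Complex.add_im, Complex.smul_re,
    Complex.smul_im, smul_eq_mul]
  ring

lemma neg_notMem_range (hell : ∀ X, B X X = 0 → X = 0)
    (hrange : Set.range (fun X ↦ B X X) ≠ Set.univ) {z : ℂ} (hz : z ≠ 0)
    (hzr : z ∈ Set.range fun X ↦ B X X) : -z ∉ Set.range fun X ↦ B X X := by
  rintro ⟨Y, hY⟩
  obtain ⟨X, hX⟩ := hzr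
  exact hrange (Set.range_eq_univ.2 (surjective_of_antipodal B hell hz hX hY))

lemma ne_zero_of_mem_interior_range (hell : ∀ X, B X X = 0 → X = 0)
    (hrange : Set.range (fun X ↦ B X X) ≠ Set.univ) {z : ℂ}
    (hz : z ∈ interior (Set.range fun X ↦ B X X)) : z ≠ 0 := by
  rintro rfl
  obtain ⟨δ, hδ, h⟩ := Metric.mem_nhds_iff.1 (mem_interior_iff_mem_nhds.1 hz)
  have hmem : ((δ / 2 : ℝ) : ℂ) ∈ Metric.ball (0 : ℂ) δ := by
    rw [mem_ball_zero_iff, Complex.norm_real, Real.norm_eq_abs, abs_of_pos] <;> linarith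
  refine neg_notMem_range B hell hrange ?_ (h hmem) (h ?_)
  · exact_mod_cast (by positivity : δ / 2 ≠ 0)
  · simpa only [mem_ball_zero_iff, norm_neg] using hmem

lemma exists_poissonBracket_ne_zero (hell : ∀ X, B X X = 0 → X = 0)
    (hrange : Set.range (fun X ↦ B X X) ≠ Set.univ)
    (hnn : ∃ X, poissonBracket (fun X ↦ (B X X).re) (fun X ↦ (B X X).im) X ≠ 0)
    {z : ℂ} (hz : z ∈ interior (Set.range fun X ↦ B X X)) :
    ∃ X, B X X = z ∧ poissonBracket (fun X ↦ (B X X).re) (fun X ↦ (B X X).im) X ≠ 0 := by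
  by_contra! hcon
  have hz0 := ne_zero_of_mem_interior_range B hell hrange hz
  have hneg := neg_notMem_range B hell hrange hz0 (interior_subset hz)
  have hclosed := isClosed_range_of_elliptic B hell
  obtain ⟨⟨w, hw, hwim⟩, w', ⟨Y, rfl⟩, hY⟩ := exists_frontier_of_interior hclosed hz0 hz hneg
  rw [hclosed.frontier_eq] at hw
  obtain ⟨⟨X, rfl⟩, hX⟩ := hw
  obtain ⟨Z, hZ⟩ := hnn
  refine hZ ((quadraticOnLines_poissonBracket B).eq_zero_of_null_cone
    (quadraticOnLines_im_div B z) (fun V hV ↦ ?_) hwim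
    (not_not.1 fun h ↦ hX (mem_interior_range_of_poissonBracket_ne_zero B h)) hY Z)
  set r := (B V V / z).re with hr
  have hVz : B V V = r * z := by
    have : B V V / z = r := Complex.ext (by simp [hr]) (by simpa using hV)
    rw [← this]; field_simp
  have hscale : ∀ s : ℝ, B (s • V) (s • V) = ((s ^ 2 * r : ℝ) : ℂ) * z := by
    intro s
    simp only [map_smul, LinearMap.smul_apply, Complex.real_smul, hVz]
    push_cast; ring
  rcases lt_trichotomy r 0 with h | h | h
  · refine absurd ⟨(√(-r))⁻¹ • V, ?_⟩ hneg
    simp only [hscale, inv_pow, Real.sq_sqrt (neg_pos.2 h).le]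
    rw [show (-r)⁻¹ * r = -1 by rw [inv_neg, neg_mul, inv_mul_cancel₀ h.ne]]
    simp
  · have : V = (0 : ℝ) • V := by
      rw [zero_smul]; exact hell V (by rw [hVz, h]; simp)
    rw [this, poissonBracket_smul]
    simp
  · have h₁ := hcon ((√r)⁻¹ • V) (by
      rw [hscale, inv_pow, Real.sq_sqrt h.le, inv_mul_cancel₀ h.ne']
      simp)
    rw [poissonBracket_smul] at h₁
    exact (mul_eq_zero.1 h₁).resolve_left (by positivity)

end PoissonBracket

/-- for a non-normal elliptic quadratic form with `Σ(q) ≠ ℂ`,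
every interior point of the numerical range is attained at some point where
`{Re q, Im q} ≠ 0`; equivalently, the set of values `z` all of whose
preimages satisfy `{Re q, Im q} = 0` is exactly the boundary `∂Σ(q)`. -/
theorem interior_points_have_nonvanishing_bracket {n : ℕ} (hn : 1 ≤ n)
    (q : ((Fin n → ℝ) × (Fin n → ℝ)) → ℂ)
    (hq : IsCQuadForm q)
    (hell : ∀ X, q X = 0 → X = 0)
    (hrange : Set.range q ≠ Set.univ)
    (hnn : ∃ X, poissonBracket (fun X => (q X).re) (fun X => (q X).im) X ≠ 0) :
    (∀ z ∈ interior (Set.range q),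
      ∃ X : (Fin n → ℝ) × (Fin n → ℝ), q X = z ∧
        poissonBracket (fun X => (q X).re) (fun X => (q X).im) X ≠ 0) ∧
    {z : ℂ | z ∈ Set.range q ∧ ∀ X, q X = z →
        poissonBracket (fun X => (q X).re) (fun X => (q X).im) X = 0}
      = frontier (Set.range q) := by
  obtain ⟨B, hB⟩ := hq
  obtain rfl : q = fun X ↦ B X X := funext hB
  have hint := fun z hz ↦ exists_poissonBracket_ne_zero B hell hrange hnn (z := z) hz
  refine ⟨hint, ?_⟩
  rw [(isClosed_range_of_elliptic B hell).frontier_eq]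
  ext z
  refine and_congr_right fun _ ↦ ⟨fun h hz ↦ ?_, ?_⟩
  · obtain ⟨X, hX, hne⟩ := hint z hz
    exact hne (h X hX)
  · rintro h X rfl
    exact not_not.1 fun hne ↦ h (mem_interior_range_of_poissonBracket_ne_zero B hne)
end

section
/- Let N ≥ 1 and let r and p be real quadratic forms on ℝᴺ. Assume that r is indefinite, i.e. there exist points y⁺ and y⁻ in ℝᴺ with r(y⁺) > 0 and r(y⁻) < 0, and assume that p vanishes on the zero set of r, i.e. r(y) = 0 implies p(y) = 0 for all y ∈ ℝᴺ. Then there exists λ ∈ ℝ such that p = λ·r. -/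
/-- A map `p : E → ℝ` is a real quadratic form if it is given by a
real-bilinear form evaluated on the diagonal. -/
def IsRQuadForm {E : Type*} [AddCommGroup E] [Module ℝ E] (p : E → ℝ) : Prop :=
  ∃ B : E →ₗ[ℝ] E →ₗ[ℝ] ℝ, ∀ X, p X = B X X

/-- If `a < 0 < c` and `A t² + B t + C` vanishes at every real root of `a t² + b t + c`, then
`(A, C)` is proportional to `(a, c)`. -/
theorem mul_eq_mul_of_quadratic_roots_subset {a b c A B C : ℝ} (ha : a < 0) (hc : 0 < c)
    (h : ∀ t : ℝ, a * t ^ 2 + b * t + c = 0 → A * t ^ 2 + B * t + C = 0) :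
    C * a = A * c := by
  have hac : a * c < 0 := mul_neg_of_neg_of_pos ha hc
  have hD : 0 < b ^ 2 - 4 * a * c := by nlinarith [sq_nonneg b]
  obtain ⟨s, hs, hss⟩ : ∃ s : ℝ, 0 < s ∧ s ^ 2 = b ^ 2 - 4 * a * c :=
    ⟨√(b ^ 2 - 4 * a * c), Real.sqrt_pos.2 hD, Real.sq_sqrt hD.le⟩
  have hroot (σ : ℝ) (hσ : σ ^ 2 = s ^ 2) :
      a * ((-b + σ) / (2 * a)) ^ 2 + b * ((-b + σ) / (2 * a)) + c = 0 := by
    have := ha.ne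
    field_simp
    linear_combination hσ + hss
  have hne : (-b + s) / (2 * a) - (-b + -s) / (2 * a) ≠ 0 := by
    rw [← sub_div]
    exact div_ne_zero (by linarith) (by linarith)
  have h₁ := hroot s rfl
  have h₂ := hroot (-s) (neg_sq s)
  generalize (-b + s) / (2 * a) = t₁ at *
  generalize (-b + -s) / (2 * a) = t₂ at *
  have hc' : c = a * (t₁ * t₂) :=
    mul_left_cancel₀ hne (by linear_combination t₁ * h₂ - t₂ * h₁)
  have hC : C = A * (t₁ * t₂) :=
    mul_left_cancel₀ hne (by linear_combination t₁ * h t₂ h₂ - t₂ * h t₁ h₁)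
  rw [hC, hc']
  ring

/-- A bilinear form on the diagonal, expanded along a line. -/
theorem LinearMap.apply_add_smul_self {E : Type*} [AddCommGroup E] [Module ℝ E]
    (B : E →ₗ[ℝ] E →ₗ[ℝ] ℝ) (u v : E) (t : ℝ) :
    B (u + t • v) (u + t • v) = B v v * t ^ 2 + (B u v + B v u) * t + B u u := by
  simp only [map_add, map_smul, LinearMap.add_apply, LinearMap.smul_apply, smul_eq_mul]
  ring

/-- A quadratic form `p` vanishing on the zero set of a quadratic form `r` has the same ratio
to `r` at a point where `r` is positive and a point where `r` is negative. -/
theorem IsRQuadForm.mul_eq_mul_of_vanishing {E : Type*} [AddCommGroup E] [Module ℝ E]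
    {r p : E → ℝ} (hr : IsRQuadForm r) (hp : IsRQuadForm p) (hvan : ∀ y, r y = 0 → p y = 0)
    {u v : E} (hu : 0 < r u) (hv : r v < 0) : p u * r v = p v * r u := by
  obtain ⟨R, hR⟩ := hr
  obtain ⟨P, hP⟩ := hp
  simp only [hR, hP] at *
  refine mul_eq_mul_of_quadratic_roots_subset (b := R u v + R v u) (B := P u v + P v u) hv hu
    fun t ht => ?_
  rw [← LinearMap.apply_add_smul_self] at ht ⊢
  exact hvan _ ht

/-- if a real quadratic form `r` is indefinite and a real
quadratic form `p` vanishes on the zero set of `r`, then `p` is a real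
multiple of `r`. -/
theorem proportional_of_vanishing_on_indefinite_zero_set {N : ℕ} (hN : 1 ≤ N)
    (r p : (Fin N → ℝ) → ℝ) (hr : IsRQuadForm r) (hp : IsRQuadForm p)
    (hind : (∃ y : Fin N → ℝ, 0 < r y) ∧ (∃ y : Fin N → ℝ, r y < 0))
    (hvan : ∀ y : Fin N → ℝ, r y = 0 → p y = 0) :
    ∃ lam : ℝ, ∀ y : Fin N → ℝ, p y = lam * r y := by
  obtain ⟨⟨u, hu⟩, ⟨v, hv⟩⟩ := hind
  refine ⟨p u / r u, fun y => ?_⟩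
  have huv := hr.mul_eq_mul_of_vanishing hp hvan hu hv
  rw [div_mul_eq_mul_div, eq_div_iff hu.ne']
  rcases lt_trichotomy (r y) 0 with hy | hy | hy
  · exact (hr.mul_eq_mul_of_vanishing hp hvan hu hy).symm
  · simp [hy, hvan y hy]
  · refine mul_right_cancel₀ hv.ne ?_
    linear_combination
      r u * hr.mul_eq_mul_of_vanishing hp hvan hy hv - r y * huv
end

section
/- Let r be a nonzero real number and b a complex number with Im b ≠ 0. If the map (x, ξ) ↦ (ξ − i r x)(ξ + b x) from ℝ² to ℂ is surjective (i.e. its range is all of ℂ), then r · Im b < 0. -/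
/-- if the map `(x, ξ) ↦ (ξ − i r x)(ξ + b x)` (with `r ≠ 0`
real and `Im b ≠ 0`) is surjective onto `ℂ`, then `r · Im b < 0`. -/
theorem surjective_implies_neg_product (r : ℝ) (hr : r ≠ 0) (b : ℂ)
    (hb : b.im ≠ 0)
    (hsurj : ∀ w : ℂ, ∃ x ξ : ℝ,
      ((ξ : ℂ) - Complex.I * (r : ℂ) * (x : ℂ)) * ((ξ : ℂ) + b * (x : ℂ)) = w) :
    r * b.im < 0 := by
  by_contra! hpos
  -- The value `-1` is not attained when `r * b.im` is nonnegative.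
  obtain ⟨x, ξ, h⟩ := hsurj (-1)
  have hre : ξ ^ 2 + b.re * ξ * x + r * b.im * x ^ 2 = -1 := by
    have := congrArg Complex.re h
    simp at this
    linarith
  have him : x * ((b.im - r) * ξ - r * b.re * x) = 0 := by
    have := congrArg Complex.im h
    simp at this
    linarith
  rcases mul_eq_zero.mp him with hx | hx
  · subst hx
    nlinarith [sq_nonneg ξ]
  have hline : (b.im - r) * ξ = r * b.re * x := sub_eq_zero.mp hx
  by_cases hq : b.im - r = 0
  · have hpx : b.re * x = 0 := by
      rw [hq, zero_mul, mul_assoc] at hline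
      exact (mul_eq_zero.mp hline.symm).resolve_left hr
    have hcross : b.re * ξ * x = 0 := by
      linear_combination ξ * hpx
    nlinarith [sq_nonneg ξ, mul_nonneg hpos (sq_nonneg x)]
  · have hkey : r * b.im * (x ^ 2 * (b.re ^ 2 + (b.im - r) ^ 2)) = -(b.im - r) ^ 2 := by
      linear_combination (b.im - r) ^ 2 * hre -
        ((b.im - r) * ξ + r * b.re * x + (b.im - r) * b.re * x) * hline
    have hnonneg : 0 ≤ r * b.im * (x ^ 2 * (b.re ^ 2 + (b.im - r) ^ 2)) :=
      mul_nonneg hpos (by positivity)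
    have : 0 < (b.im - r) ^ 2 := by positivity
    linarith
end

section
/- Let α ∈ ℂ, α ≠ 0, and η ∈ ℂ. If Im η > 0, then the map (x, ξ) ↦ α(ξ + ix)(ξ + ηx) from ℝ² to ℂ is surjective, and if Im η < 0, then the map (x, ξ) ↦ α(ξ − ix)(ξ + ηx) from ℝ² to ℂ is surjective; in both cases the numerical range of the corresponding quadratic form equals all of ℂ. -/
/-- A quadratic with positive leading and negative constant coefficient has a positive root. -/
theorem exists_pos_root_of_neg_const {A m c : ℝ} (hA : 0 < A) (hc : 0 < c) :
    ∃ t : ℝ, 0 < t ∧ A * t ^ 2 + m * t - c = 0 := by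
  have hAc : 0 < A * c := mul_pos hA hc
  have hs := Real.sq_sqrt (show 0 ≤ m ^ 2 + 4 * (A * c) by positivity)
  have hlt : m < √(m ^ 2 + 4 * (A * c)) := Real.lt_sqrt_of_sq_lt (by linarith)
  generalize √(m ^ 2 + 4 * (A * c)) = s at hs hlt
  refine ⟨(s - m) / (2 * A), div_pos (by linarith) (by positivity), ?_⟩
  field_simp
  linear_combination hs

/-- The real and imaginary parts of `(y + ix)(y + (a + ib)x)` take every pair of values
if `0 < b`. -/
theorem exists_re_im_normal_form (a p q : ℝ) {b : ℝ} (hb : 0 < b) :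
    ∃ x y : ℝ, y ^ 2 + a * y * x - b * x ^ 2 = p ∧ x * ((1 + b) * y + a * x) = q := by
  have hb1 : 0 < 1 + b := by linarith
  have hC : 0 < b * ((1 + b) ^ 2 + a ^ 2) := by positivity
  rcases eq_or_ne q 0 with rfl | hq
  · rcases le_total 0 p with hp | hp
    · exact ⟨0, √p, by simp [Real.sq_sqrt hp], by simp⟩
    · have hs := Real.sq_sqrt
        (div_nonneg (neg_nonneg.mpr hp) hC.le)
      generalize √(-p / (b * ((1 + b) ^ 2 + a ^ 2))) = s at hs
      rw [eq_div_iff hC.ne'] at hs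
      refine ⟨(1 + b) * s, -a * s, ?_, by ring⟩
      linear_combination -hs
  · obtain ⟨t, ht, h⟩ := exists_pos_root_of_neg_const
      (m := p * (1 + b) ^ 2 - a * q * (b - 1)) hC (sq_pos_of_ne_zero hq)
    have hx := Real.sqrt_pos.mpr ht
    have hs := Real.sq_sqrt ht.le
    generalize √t = x at hx hs
    subst hs
    refine ⟨x, (q / x - a * x) / (1 + b), ?_, ?_⟩
    · field_simp
      linear_combination -h
    · field_simp
      ring

theorem exists_normal_form_eq {η : ℂ} (hη : 0 < η.im) (z : ℂ) :
    ∃ x y : ℝ, ((y : ℂ) + Complex.I * x) * (y + η * x) = z := by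
  obtain ⟨x, y, hre, him⟩ := exists_re_im_normal_form η.re z.re z.im hη
  refine ⟨x, y, Complex.ext ?_ ?_⟩
  · simp
    linear_combination hre
  · simp
    linear_combination him

/-- for `α ≠ 0`, if `Im η > 0` then the quadratic form
`(x, ξ) ↦ α(ξ + ix)(ξ + ηx)` has numerical range all of `ℂ`, and if
`Im η < 0` then `(x, ξ) ↦ α(ξ − ix)(ξ + ηx)` has numerical range all of
`ℂ`. -/
theorem range_eq_univ_of_normal_forms (α : ℂ) (hα : α ≠ 0) (η : ℂ) :
    (0 < η.im →
      Set.range (fun X : ℝ × ℝ =>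
        α * ((X.2 : ℂ) + Complex.I * (X.1 : ℂ)) * ((X.2 : ℂ) + η * (X.1 : ℂ)))
        = Set.univ) ∧
    (η.im < 0 →
      Set.range (fun X : ℝ × ℝ =>
        α * ((X.2 : ℂ) - Complex.I * (X.1 : ℂ)) * ((X.2 : ℂ) + η * (X.1 : ℂ)))
        = Set.univ) := by
  refine ⟨fun hη => Set.eq_univ_of_forall fun w => ?_,
    fun hη => Set.eq_univ_of_forall fun w => ?_⟩
  · obtain ⟨x, y, h⟩ := exists_normal_form_eq hη (w / α)
    refine ⟨(x, y), ?_⟩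
    simp only [mul_assoc, h, mul_div_cancel₀ w hα]
  · obtain ⟨x, y, h⟩ := exists_normal_form_eq (η := -η) (by simpa using hη) (w / α)
    refine ⟨(-x, y), ?_⟩
    rw [eq_div_iff hα] at h
    push_cast
    linear_combination h
end

section
/- Let n ≥ 1 and λ₁, …, λₙ > 0. Let Y = (x(t), ξ(t)) : ℝ → ℝⁿ × ℝⁿ be a differentiable function satisfying for all t ∈ ℝ and all j = 1, …, n the linear system xⱼ′(t) = 2λⱼ ξⱼ(t) and ξⱼ′(t) = −2λⱼ xⱼ(t). Then for every t₀ ∈ ℝ, every ε > 0 and every M > 0, there exist T₁ > M and T₂ > M such that |Y(t₀ + T₁) − Y(t₀)| < ε and |Y(t₀ − T₂) − Y(t₀)| < ε, where |·| denotes the Euclidean norm on ℝ^{2n}. -/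
open Filter Topology in
/-- A bounded sequence of phase-space points has two distinct terms that are arbitrarily close. -/
lemma exists_lt_sum_sq_sub_lt {n : ℕ} (p q : ℕ → Fin n → ℝ) (C : ℝ)
    (hp : ∀ k j, |p k j| ≤ C) (hq : ∀ k j, |q k j| ≤ C) {δ : ℝ} (hδ : 0 < δ) :
    ∃ k l, k < l ∧ ∑ j, ((p l j - p k j) ^ 2 + (q l j - q k j) ^ 2) < δ := by
  let K : Set (Fin n → ℝ × ℝ) := Set.univ.pi fun _ => Set.Icc (-C) C ×ˢ Set.Icc (-C) C
  have hK : IsCompact K := isCompact_univ_pi fun _ => isCompact_Icc.prod isCompact_Icc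
  obtain ⟨a, -, φ, hφ, hlim⟩ := hK.tendsto_subseq (x := fun k j => (p k j, q k j))
    fun k j _ => ⟨abs_le.mp (hp k j), abs_le.mp (hq k j)⟩
  have hlim' := hlim.comp (tendsto_add_atTop_nat 1)
  have hdist : Continuous fun z : (Fin n → ℝ × ℝ) × (Fin n → ℝ × ℝ) =>
      ∑ j, (((z.1 j).1 - (z.2 j).1) ^ 2 + ((z.1 j).2 - (z.2 j).2) ^ 2) := by
    fun_prop
  have hzero := (hdist.tendsto (a, a)).comp (hlim'.prodMk_nhds hlim)
  obtain ⟨k, hk⟩ := (hzero.eventually (gt_mem_nhds (by simpa using hδ))).exists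
  exact ⟨φ k, φ (k + 1), hφ k.lt_succ_self, hk⟩

/-- The energy of a harmonic oscillator is conserved. -/
lemma harmonic_energy_eq {c : ℝ} {u v : ℝ → ℝ} (hu : ∀ t, HasDerivAt u (2 * c * v t) t)
    (hv : ∀ t, HasDerivAt v (-2 * c * u t) t) (s t : ℝ) :
    u s ^ 2 + v s ^ 2 = u t ^ 2 + v t ^ 2 := by
  have h : ∀ r, HasDerivAt (fun r => u r ^ 2 + v r ^ 2) 0 r := fun r => by
    refine (((hu r).fun_pow 2).fun_add ((hv r).fun_pow 2)).congr_deriv ?_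
    push_cast
    ring
  exact is_const_of_deriv_eq_zero (fun r => (h r).differentiableAt) (fun r => (h r).deriv) s t

/-- The flow of a harmonic oscillator acts by isometries of the phase plane. -/
lemma harmonic_sq_dist_add {c : ℝ} {u v : ℝ → ℝ} (hu : ∀ t, HasDerivAt u (2 * c * v t) t)
    (hv : ∀ t, HasDerivAt v (-2 * c * u t) t) (s t h : ℝ) :
    (u (s + h) - u (t + h)) ^ 2 + (v (s + h) - v (t + h)) ^ 2 =
      (u s - u t) ^ 2 + (v s - v t) ^ 2 := by
  have key := harmonic_energy_eq (c := c)
    (u := fun r => u (s + r) - u (t + r)) (v := fun r => v (s + r) - v (t + r))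
    (fun r => ((hu (s + r)).comp_const_add s r).fun_sub ((hu (t + r)).comp_const_add t r)
      |>.congr_deriv (by ring))
    (fun r => ((hv (s + r)).comp_const_add s r).fun_sub ((hv (t + r)).comp_const_add t r)
      |>.congr_deriv (by ring)) h 0
  simpa using key

/-- the flow of the Hamiltonian system `xⱼ′ = 2λⱼξⱼ`,
`ξⱼ′ = −2λⱼxⱼ` (with `λⱼ > 0`) comes back arbitrarily close to any of its
points for arbitrarily large positive and negative times. -/
theorem hamiltonian_flow_recurrence {n : ℕ} (hn : 1 ≤ n)
    (lam : Fin n → ℝ) (hlam : ∀ j, 0 < lam j)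
    (x ξ : ℝ → (Fin n → ℝ))
    (hx : ∀ t : ℝ, ∀ j : Fin n,
      HasDerivAt (fun s => x s j) (2 * lam j * ξ t j) t)
    (hξ : ∀ t : ℝ, ∀ j : Fin n,
      HasDerivAt (fun s => ξ s j) (-2 * lam j * x t j) t) :
    ∀ t₀ : ℝ, ∀ ε > (0 : ℝ), ∀ M > (0 : ℝ),
      ∃ T₁ > M, ∃ T₂ > M,
        Real.sqrt (∑ j, ((x (t₀ + T₁) j - x t₀ j) ^ 2
            + (ξ (t₀ + T₁) j - ξ t₀ j) ^ 2)) < ε ∧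
        Real.sqrt (∑ j, ((x (t₀ - T₂) j - x t₀ j) ^ 2
            + (ξ (t₀ - T₂) j - ξ t₀ j) ^ 2)) < ε := by
  intro t₀ ε hε M hM
  have henergy := fun j => harmonic_energy_eq (fun t => hx t j) (fun t => hξ t j)
  have hshift : ∀ s t h, ∑ j, ((x (s + h) j - x (t + h) j) ^ 2 + (ξ (s + h) j - ξ (t + h) j) ^ 2) =
      ∑ j, ((x s j - x t j) ^ 2 + (ξ s j - ξ t j) ^ 2) := fun s t h =>
    Finset.sum_congr rfl fun j _ =>
      harmonic_sq_dist_add (fun t => hx t j) (fun t => hξ t j) s t h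
  let C : ℝ := Real.sqrt (∑ j, (x t₀ j ^ 2 + ξ t₀ j ^ 2))
  have hbound : ∀ t j, x t j ^ 2 + ξ t j ^ 2 ≤ ∑ j, (x t₀ j ^ 2 + ξ t₀ j ^ 2) := fun t j =>
    (henergy j t t₀).trans_le <| Finset.single_le_sum
      (f := fun j => x t₀ j ^ 2 + ξ t₀ j ^ 2) (fun _ _ => by positivity) (Finset.mem_univ j)
  obtain ⟨k, l, hkl, hclose⟩ := exists_lt_sum_sq_sub_lt
    (fun k : ℕ => x (t₀ + k * (M + 1))) (fun k : ℕ => ξ (t₀ + k * (M + 1))) C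
    (fun k j => Real.abs_le_sqrt <|
      (le_add_of_nonneg_right (sq_nonneg _)).trans (hbound _ j))
    (fun k j => Real.abs_le_sqrt <|
      (le_add_of_nonneg_left (sq_nonneg _)).trans (hbound _ j))
    (pow_pos hε 2)
  have hkl' : (k : ℝ) + 1 ≤ l := by exact_mod_cast hkl
  obtain ⟨T, hT⟩ : ∃ T : ℝ, T = (l - k) * (M + 1) := ⟨_, rfl⟩
  have hMT : M < T := by nlinarith
  have hforward := hshift (t₀ + T) t₀ (k * (M + 1))
  rw [show t₀ + T + k * (M + 1) = t₀ + l * (M + 1) by rw [hT]; ring] at hforward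
  have hbackward := hshift (t₀ - T) t₀ T
  rw [sub_add_cancel] at hbackward
  have hsymm : ∑ j, ((x t₀ j - x (t₀ + T) j) ^ 2 + (ξ t₀ j - ξ (t₀ + T) j) ^ 2) =
      ∑ j, ((x (t₀ + T) j - x t₀ j) ^ 2 + (ξ (t₀ + T) j - ξ t₀ j) ^ 2) :=
    Finset.sum_congr rfl fun j _ => by ring
  refine ⟨T, hMT, T, hMT, ?_, ?_⟩
  · rw [Real.sqrt_lt' hε, ← hforward]
    exact hclose
  · rw [Real.sqrt_lt' hε, ← hbackward, hsymm, ← hforward]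
    exact hclose
end

section
/- Let n ≥ 1 and let q be a complex-valued quadratic form on ℝ^{2n} = ℝⁿ_x × ℝⁿ_ξ whose real part is Re q(x, ξ) = Σⱼ λⱼ(ξⱼ² + xⱼ²) with λⱼ > 0 for all j. Let (x₀, ξ₀) ∈ ℝ^{2n} be such that {Re q, Im q}(x₀, ξ₀) > 0, let Y : ℝ → ℝ^{2n} be the solution of the Cauchy problem Y′(t) = H_{Re q}(Y(t)), Y(0) = (x₀, ξ₀), and set z = q(x₀, ξ₀). Then there exist real times 0 < t₁ < t₂ such that Im q(Y(t₁)) > Im z > Im q(Y(t₂)); that is, the imaginary part of q − z changes sign from positive to negative values along the oriented bicharacteristic Y of Re q − Re z. -/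
/-- The Hamilton vector field `H_f = (∂f/∂ξ, −∂f/∂x)` of a function `f` on
`ℝⁿ_x × ℝⁿ_ξ`. -/
noncomputable def hamVectorField {n : ℕ}
    (f : ((Fin n → ℝ) × (Fin n → ℝ)) → ℝ)
    (p : (Fin n → ℝ) × (Fin n → ℝ)) : (Fin n → ℝ) × (Fin n → ℝ) :=
  (fun j => fderiv ℝ f p (0, Pi.single j 1),
   fun j => -fderiv ℝ f p (Pi.single j 1, 0))

/-- A linear oscillator conserves `a ^ 2 + b ^ 2`. -/
theorem oscillator_sq_add_sq_const {a b : ℝ → ℝ} {c : ℝ}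
    (ha : ∀ t, HasDerivAt a (c * b t) t) (hb : ∀ t, HasDerivAt b (-(c * a t)) t) (s t : ℝ) :
    a s ^ 2 + b s ^ 2 = a t ^ 2 + b t ^ 2 := by
  have h : ∀ r, HasDerivAt (fun r => a r ^ 2 + b r ^ 2) 0 r := fun r => by
    refine (((ha r).pow 2).add ((hb r).pow 2)).congr_deriv ?_
    push_cast
    ring
  exact is_const_of_deriv_eq_zero (fun r => (h r).differentiableAt) (fun r => (h r).deriv) s t

/-- A trajectory of a finite system of uncoupled linear oscillators returns arbitrarily close to
each of its points, after a time at least one. -/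
theorem oscillators_recurrent {ι : Type*} [Fintype ι] {c : ι → ℝ} {Y : ℝ → (ι → ℝ) × (ι → ℝ)}
    (ha : ∀ j t, HasDerivAt (fun s => (Y s).1 j) (c j * (Y t).2 j) t)
    (hb : ∀ j t, HasDerivAt (fun s => (Y s).2 j) (-(c j * (Y t).1 j)) t)
    (u : ℝ) {ε : ℝ} (hε : 0 < ε) : ∃ T : ℝ, 1 ≤ T ∧ dist (Y (u + T)) (Y u) < ε := by
  have hbound : ∀ t, Y t ∈ Metric.closedBall (0 : (ι → ℝ) × (ι → ℝ))
      (∑ i, ((Y 0).1 i ^ 2 + (Y 0).2 i ^ 2) + 1) := by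
    intro t
    have hS : ∀ j, (Y t).1 j ^ 2 + (Y t).2 j ^ 2 ≤ ∑ i, ((Y 0).1 i ^ 2 + (Y 0).2 i ^ 2) := by
      intro j
      rw [oscillator_sq_add_sq_const (ha j) (hb j) t 0]
      exact Finset.single_le_sum (f := fun i => (Y 0).1 i ^ 2 + (Y 0).2 i ^ 2)
        (fun i _ => by positivity) (Finset.mem_univ j)
    have hS0 : 0 ≤ ∑ i, ((Y 0).1 i ^ 2 + (Y 0).2 i ^ 2) :=
      Finset.sum_nonneg fun i _ => by positivity
    rw [mem_closedBall_zero_iff, Prod.norm_def, max_le_iff, pi_norm_le_iff_of_nonneg (by linarith),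
      pi_norm_le_iff_of_nonneg (by linarith)]
    constructor <;> intro j <;> rw [Real.norm_eq_abs] <;> apply abs_le_of_sq_le_sq _ (by linarith)
      <;> nlinarith [hS j, sq_nonneg ((Y t).1 j), sq_nonneg ((Y t).2 j)]
  obtain ⟨y, -, φ, hφ, hlim⟩ := (isCompact_closedBall (0 : (ι → ℝ) × (ι → ℝ)) _).tendsto_subseq
    (x := fun k : ℕ => Y (u + k)) (fun k => hbound _)
  obtain ⟨N, hN⟩ := Metric.cauchySeq_iff.1 hlim.cauchySeq (ε / 2) (by positivity)
  have hclose := hN (N + 1) (Nat.le_succ N) N le_rfl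
  have hlt : φ N + 1 ≤ φ (N + 1) := hφ (Nat.lt_succ_self N)
  have hlt' : (φ N : ℝ) + 1 ≤ φ (N + 1) := by exact_mod_cast hlt
  refine ⟨φ (N + 1) - φ N, by linarith, ?_⟩
  set T : ℝ := φ (N + 1) - φ N with hT
  have hshift : u + (φ (N + 1) : ℝ) = u + φ N + T := by rw [hT]; ring
  simp only [Function.comp_apply, hshift] at hclose
  have hcons : ∀ j, ((Y (u + T)).1 j - (Y u).1 j) ^ 2 + ((Y (u + T)).2 j - (Y u).2 j) ^ 2 =
      ((Y (u + φ N + T)).1 j - (Y (u + φ N)).1 j) ^ 2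
        + ((Y (u + φ N + T)).2 j - (Y (u + φ N)).2 j) ^ 2 := by
    intro j
    refine oscillator_sq_add_sq_const (a := fun s => (Y (s + T)).1 j - (Y s).1 j)
      (b := fun s => (Y (s + T)).2 j - (Y s).2 j) (c := c j) (fun t => ?_) (fun t => ?_) u (u + φ N)
    · exact (((ha j (t + T)).comp_add_const t T).sub (ha j t)).congr_deriv (by ring)
    · exact (((hb j (t + T)).comp_add_const t T).sub (hb j t)).congr_deriv (by ring)
  rw [Prod.dist_eq, max_lt_iff, dist_pi_lt_iff (by positivity),
    dist_pi_lt_iff (by positivity)] at hclose ⊢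
  have hsq : ∀ j, ((Y (u + T)).1 j - (Y u).1 j) ^ 2 + ((Y (u + T)).2 j - (Y u).2 j) ^ 2
      < ε ^ 2 := by
    intro j
    have h1 := hclose.1 j
    have h2 := hclose.2 j
    rw [Real.dist_eq] at h1 h2
    have h1' := sq_lt_sq' (abs_lt.1 h1).1 (abs_lt.1 h1).2
    have h2' := sq_lt_sq' (abs_lt.1 h2).1 (abs_lt.1 h2).2
    rw [hcons j]
    nlinarith
  constructor <;> intro j <;> rw [Real.dist_eq] <;> apply abs_lt_of_sq_lt_sq _ hε.le
    <;> nlinarith [hsq j, sq_nonneg ((Y (u + T)).1 j - (Y u).1 j),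
      sq_nonneg ((Y (u + T)).2 j - (Y u).2 j)]

/-- A function with positive derivative at a point takes larger values just after it, and smaller
values just before it. -/
theorem HasDerivAt.exists_lt_and_exists_gt_of_pos {f : ℝ → ℝ} {f' a δ : ℝ}
    (hf : HasDerivAt f f' a) (hf' : 0 < f') (hδ : 0 < δ) :
    (∃ t, a < t ∧ t < a + δ ∧ f a < f t) ∧ ∃ s, a - δ < s ∧ s < a ∧ f s < f a := by
  have h := (hasDerivAt_iff_tendsto_slope.1 hf).eventually (lt_mem_nhds hf')
  rw [eventually_nhdsWithin_iff, Metric.eventually_nhds_iff] at h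
  obtain ⟨η, hη, h⟩ := h
  have hm : 0 < min η δ := lt_min hη hδ
  have hmη := min_le_left η δ
  have hmδ := min_le_right η δ
  refine ⟨⟨a + min η δ / 2, by linarith, by linarith, ?_⟩,
    ⟨a - min η δ / 2, by linarith, by linarith, ?_⟩⟩
  · have := h (y := a + min η δ / 2)
      (by rw [Real.dist_eq, abs_lt]; constructor <;> linarith)
      (by simp only [Set.mem_compl_iff, Set.mem_singleton_iff]; linarith)
    rw [slope_def_field, div_pos_iff_of_pos_right (by linarith)] at this
    linarith
  · have := h (y := a - min η δ / 2)
      (by rw [Real.dist_eq, abs_lt]; constructor <;> linarith)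
      (by simp only [Set.mem_compl_iff, Set.mem_singleton_iff]; linarith)
    rw [slope_def_field, div_pos_iff] at this
    rcases this with h | h <;> linarith

theorem IsCQuadForm.differentiable {E : Type*} [NormedAddCommGroup E] [NormedSpace ℝ E]
    [FiniteDimensional ℝ E] {q : E → ℂ} (hq : IsCQuadForm q) : Differentiable ℝ q := by
  obtain ⟨B, hB⟩ := hq
  let L : E →L[ℝ] E →L[ℝ] ℂ :=
    LinearMap.toContinuousLinearMap (LinearMap.toContinuousLinearMap.toLinearMap ∘ₗ B)
  have hL : q = fun X => L X X := funext hB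
  rw [hL]
  fun_prop

/-- The derivative of `g` along the Hamilton vector field of `f` is the Poisson bracket. -/
theorem fderiv_hamVectorField {n : ℕ} (f g : ((Fin n → ℝ) × (Fin n → ℝ)) → ℝ)
    (p : (Fin n → ℝ) × (Fin n → ℝ)) :
    fderiv ℝ g p (hamVectorField f p) = poissonBracket f g p := by
  have hdecomp : hamVectorField f p = ∑ j, (fderiv ℝ f p (0, Pi.single j 1) •
      ((Pi.single j 1, 0) : (Fin n → ℝ) × (Fin n → ℝ))
      - fderiv ℝ f p (Pi.single j 1, 0) • ((0, Pi.single j 1) : (Fin n → ℝ) × (Fin n → ℝ))) := by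
    ext i <;> simp [hamVectorField, Prod.fst_sum, Prod.snd_sum, Finset.sum_apply, Pi.single_apply]
  simp only [hdecomp, map_sum, map_sub, map_smul, smul_eq_mul, poissonBracket]

/-- The Hamilton vector field of `∑ⱼ λⱼ(ξⱼ² + xⱼ²)`. -/
theorem hamVectorField_sum_sq {n : ℕ} (lam : Fin n → ℝ) (p : (Fin n → ℝ) × (Fin n → ℝ)) :
    hamVectorField (fun X => ∑ j, lam j * ((X.2 j) ^ 2 + (X.1 j) ^ 2)) p =
      (fun j => 2 * lam j * p.2 j, fun j => -(2 * lam j * p.1 j)) := by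
  let P : Fin n → ((Fin n → ℝ) × (Fin n → ℝ)) →L[ℝ] ℝ := fun j =>
    (ContinuousLinearMap.proj (R := ℝ) (φ := fun _ : Fin n => ℝ) j).comp
      (ContinuousLinearMap.fst ℝ _ _)
  let Q : Fin n → ((Fin n → ℝ) × (Fin n → ℝ)) →L[ℝ] ℝ := fun j =>
    (ContinuousLinearMap.proj (R := ℝ) (φ := fun _ : Fin n => ℝ) j).comp
      (ContinuousLinearMap.snd ℝ _ _)
  have h : HasFDerivAt (fun X : (Fin n → ℝ) × (Fin n → ℝ) =>
      ∑ j, lam j * ((X.2 j) ^ 2 + (X.1 j) ^ 2)) _ p :=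
    HasFDerivAt.fun_sum (u := Finset.univ) fun j _ =>
      ((((Q j).hasFDerivAt (x := p)).pow 2).add (((P j).hasFDerivAt (x := p)).pow 2)).const_mul
        (lam j)
  unfold hamVectorField
  rw [h.fderiv]
  ext i <;> simp [P, Q, Pi.single_apply] <;> ring

/-- if `Re q(x, ξ) = ∑ⱼ λⱼ(ξⱼ² + xⱼ²)` with `λⱼ > 0` and
`{Re q, Im q}(x₀, ξ₀) > 0`, then along the bicharacteristic `Y` of `Re q`
with `Y(0) = (x₀, ξ₀)` the imaginary part of `q − z` (where `z = q(x₀, ξ₀)`)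
still changes sign from positive to negative values: there are times
`0 < t₁ < t₂` with `Im q(Y(t₁)) > Im z > Im q(Y(t₂))`. -/
theorem sign_change_wrong_way_case {n : ℕ} (hn : 1 ≤ n)
    (q : ((Fin n → ℝ) × (Fin n → ℝ)) → ℂ)
    (hq : IsCQuadForm q)
    (lam : Fin n → ℝ) (hlam : ∀ j, 0 < lam j)
    (hre : ∀ X : (Fin n → ℝ) × (Fin n → ℝ),
      (q X).re = ∑ j, lam j * ((X.2 j) ^ 2 + (X.1 j) ^ 2))
    (X₀ : (Fin n → ℝ) × (Fin n → ℝ))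
    (hbr : 0 < poissonBracket (fun X => (q X).re) (fun X => (q X).im) X₀)
    (Y : ℝ → (Fin n → ℝ) × (Fin n → ℝ))
    (hY : ∀ t : ℝ, HasDerivAt Y (hamVectorField (fun X => (q X).re) (Y t)) t)
    (hY0 : Y 0 = X₀)
    (z : ℂ) (hz : z = q X₀) :
    ∃ t₁ t₂ : ℝ, 0 < t₁ ∧ t₁ < t₂ ∧
      z.im < (q (Y t₁)).im ∧ (q (Y t₂)).im < z.im := by
  subst hz
  have hfield : ∀ p, hamVectorField (fun X => (q X).re) p =
      (fun j => 2 * lam j * p.2 j, fun j => -(2 * lam j * p.1 j)) := by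
    rw [funext hre]
    exact hamVectorField_sum_sq lam
  have ha : ∀ j t, HasDerivAt (fun s => (Y s).1 j) (2 * lam j * (Y t).2 j) t := fun j t => by
    have := hY t
    rw [hfield] at this
    exact hasDerivAt_pi.1 this.fst j
  have hb : ∀ j t, HasDerivAt (fun s => (Y s).2 j) (-(2 * lam j * (Y t).1 j)) t := fun j t => by
    have := hY t
    rw [hfield] at this
    exact hasDerivAt_pi.1 this.snd j
  have hdiff : Differentiable ℝ fun X => (q X).im :=
    Complex.imCLM.differentiable.comp hq.differentiable
  have hderiv : HasDerivAt (fun t => (q (Y t)).im)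
      (poissonBracket (fun X => (q X).re) (fun X => (q X).im) X₀) 0 := by
    have := (hdiff (Y 0)).hasFDerivAt.comp_hasDerivAt (0 : ℝ) (hY 0)
    rwa [fderiv_hamVectorField, hY0] at this
  obtain ⟨⟨t, ht0, ht, htq⟩, u, hu, hu0, huq⟩ :=
    hderiv.exists_lt_and_exists_gt_of_pos hbr (δ := 1 / 2) (by norm_num)
  rw [hY0] at htq huq
  obtain ⟨ε, hε, hball⟩ := Metric.eventually_nhds_iff.1
    (hdiff.continuous.continuousAt.eventually (gt_mem_nhds huq))
  obtain ⟨T, hT, hdist⟩ := oscillators_recurrent ha hb u hε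
  exact ⟨t, u + T, ht0, by linarith, htq, hball hdist⟩
end

section
/- Let N ≥ 1 and let α₁ ≤ α₂ ≤ … ≤ α_N be real numbers. Then the range of the map y ↦ Σⱼ yⱼ² + i·Σⱼ αⱼ yⱼ² from ℝᴺ to ℂ is exactly the closed angular sector {s·(1 + iα₁) + t·(1 + iα_N) : s, t ∈ ℝ, s ≥ 0, t ≥ 0}. -/
/-- for `α₁ ≤ … ≤ α_N`, the range of
`y ↦ ∑ yⱼ² + i ∑ αⱼ yⱼ²` is exactly the closed angular sector spanned by
`1 + iα₁` and `1 + iα_N`. -/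
theorem range_eq_closed_sector {N : ℕ} (hN : 1 ≤ N)
    (α : Fin N → ℝ) (hmono : ∀ i j : Fin N, i ≤ j → α i ≤ α j) :
    Set.range (fun y : Fin N → ℝ =>
        ((∑ j, (y j) ^ 2 : ℝ) : ℂ) + Complex.I * ((∑ j, α j * (y j) ^ 2 : ℝ) : ℂ))
      = {u : ℂ | ∃ s t : ℝ, 0 ≤ s ∧ 0 ≤ t ∧
          u = (s : ℂ) * (1 + Complex.I * (α ⟨0, by omega⟩ : ℂ))
            + (t : ℂ) * (1 + Complex.I * (α ⟨N - 1, by omega⟩ : ℂ))} := by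
  set i₀ : Fin N := ⟨0, by omega⟩
  set i₁ : Fin N := ⟨N - 1, by omega⟩
  ext u
  simp only [Set.mem_range, Set.mem_ofPred_eq]
  constructor
  · rintro ⟨y, rfl⟩
    have hseg : ∀ j, ∃ p q : ℝ, 0 ≤ p ∧ 0 ≤ q ∧ p + q = 1 ∧ p * α i₀ + q * α i₁ = α j := by
      intro j
      have h₀ : α i₀ ≤ α j := hmono _ _ (Fin.mk_le_of_le_val (Nat.zero_le _))
      have h₁ : α j ≤ α i₁ := hmono _ _ (Fin.le_def.2 (Nat.le_sub_one_of_lt j.isLt))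
      have hj : α j ∈ segment ℝ (α i₀) (α i₁) := by
        rw [segment_eq_Icc (h₀.trans h₁)]
        exact ⟨h₀, h₁⟩
      exact hj
    choose p q hp hq hpq hα using hseg
    have hsum : ∑ j, y j ^ 2 = ∑ j, p j * y j ^ 2 + ∑ j, q j * y j ^ 2 := by
      rw [← Finset.sum_add_distrib]
      refine Finset.sum_congr rfl fun j _ => ?_
      rw [← add_mul, hpq, one_mul]
    have hwsum : ∑ j, α j * y j ^ 2
        = (∑ j, p j * y j ^ 2) * α i₀ + (∑ j, q j * y j ^ 2) * α i₁ := by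
      rw [Finset.sum_mul, Finset.sum_mul, ← Finset.sum_add_distrib]
      refine Finset.sum_congr rfl fun j _ => ?_
      rw [← hα j]
      ring
    refine ⟨∑ j, p j * y j ^ 2, ∑ j, q j * y j ^ 2,
      Finset.sum_nonneg fun j _ => mul_nonneg (hp j) (sq_nonneg _),
      Finset.sum_nonneg fun j _ => mul_nonneg (hq j) (sq_nonneg _), ?_⟩
    rw [hsum, hwsum]
    simp only [Complex.ofReal_add, Complex.ofReal_mul]
    ring
  · rintro ⟨s, t, hs, ht, rfl⟩
    refine ⟨fun j => √((if j = i₀ then s else 0) + (if j = i₁ then t else 0)), ?_⟩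
    have hsq : ∀ j, √((if j = i₀ then s else 0) + (if j = i₁ then t else 0)) ^ 2
        = (if j = i₀ then s else 0) + (if j = i₁ then t else 0) := fun j =>
      Real.sq_sqrt (add_nonneg (by split_ifs <;> simp [hs]) (by split_ifs <;> simp [ht]))
    simp only [hsq, mul_add, Finset.sum_add_distrib, mul_ite, mul_zero, Finset.sum_ite_eq',
      Finset.mem_univ, if_true, Complex.ofReal_add, Complex.ofReal_mul]
    ring
end

section
/- Let H be a complex Hilbert space, D a linear subspace of H, and A : D → H a linear map. Let θ ∈ ℝ, μ ∈ [0, 1], C > 0 and η₀ ≥ 1 be such that for every η ≥ η₀ and every v ∈ D one has ‖Av − η e^{iθ} v‖ ≥ C⁻¹ η^{1−μ} ‖v‖. Then for every complex number z̃ such that Re(e^{−iθ} z̃) ≥ η₀ and |Im(e^{−iθ} z̃)| ≤ (2C)⁻¹ (Re(e^{−iθ} z̃))^{1−μ}, one has ‖Av − z̃ v‖ ≥ (2C)⁻¹ η₀^{1−μ} ‖v‖ for every v ∈ D. -/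
/-- The distance from `z` to the point `Re (e^{-iθ} z) e^{iθ}` of the line `e^{iθ}ℝ` is
`|Im (e^{-iθ} z)|`. -/
lemma norm_sub_re_mul_exp (θ : ℝ) (z : ℂ) :
    ‖z - ↑(Complex.exp (-θ * Complex.I) * z).re * Complex.exp (θ * Complex.I)‖
      = |(Complex.exp (-θ * Complex.I) * z).im| := by
  set w := Complex.exp (-θ * Complex.I) * z with hw
  have hz : z = w * Complex.exp (θ * Complex.I) := by
    rw [hw, mul_right_comm, ← Complex.exp_add, neg_mul, neg_add_cancel, Complex.exp_zero, one_mul]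
  have hsub : w - w.re = w.im * Complex.I := by
    rw [sub_eq_iff_eq_add', Complex.re_add_im]
  rw [hz, ← sub_mul, norm_mul, Complex.norm_exp_ofReal_mul_I, mul_one, hsub, norm_mul,
    Complex.norm_I, mul_one, Complex.norm_real, Real.norm_eq_abs]


/-- a resolvent-type lower bound along the half-line
`e^{iθ}ℝ₊` propagates to a neighbourhood of the half-line of parabolic shape
determined by the index `μ`. -/
theorem resolvent_bound_near_halfline
    {H : Type*} [NormedAddCommGroup H] [InnerProductSpace ℂ H] [CompleteSpace H]
    (D : Submodule ℂ H) (A : D →ₗ[ℂ] H)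
    (θ μ C η₀ : ℝ) (hμ : μ ∈ Set.Icc (0 : ℝ) 1) (hC : 0 < C) (hη₀ : 1 ≤ η₀)
    (hbound : ∀ η : ℝ, η₀ ≤ η → ∀ v : D,
      C⁻¹ * η ^ (1 - μ) * ‖(v : H)‖
        ≤ ‖A v - (↑η * Complex.exp (θ * Complex.I)) • (v : H)‖) :
    ∀ z : ℂ, η₀ ≤ (Complex.exp (-θ * Complex.I) * z).re →
      |(Complex.exp (-θ * Complex.I) * z).im|
        ≤ (2 * C)⁻¹ * ((Complex.exp (-θ * Complex.I) * z).re) ^ (1 - μ) →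
      ∀ v : D, (2 * C)⁻¹ * η₀ ^ (1 - μ) * ‖(v : H)‖ ≤ ‖A v - z • (v : H)‖ := by
  intro z hre him v
  have hdist := norm_sub_re_mul_exp θ z
  have hv := hbound _ hre v
  set η := (Complex.exp (-θ * Complex.I) * z).re
  set e := Complex.exp (θ * Complex.I)
  have hpow : η₀ ^ (1 - μ) ≤ η ^ (1 - μ) :=
    Real.rpow_le_rpow (by linarith) hre (by linarith [hμ.2])
  have htri : ‖A v - (η * e) • (v : H)‖ ≤ ‖A v - z • (v : H)‖ + ‖z - η * e‖ * ‖(v : H)‖ := by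
    rw [← norm_smul, sub_smul]
    exact norm_sub_le_norm_sub_add_norm_sub _ _ _
  have hshift : ‖z - η * e‖ * ‖(v : H)‖ ≤ (2 * C)⁻¹ * η ^ (1 - μ) * ‖(v : H)‖ := by
    rw [hdist]
    gcongr
  calc (2 * C)⁻¹ * η₀ ^ (1 - μ) * ‖(v : H)‖
      ≤ (2 * C)⁻¹ * η ^ (1 - μ) * ‖(v : H)‖ := by gcongr
    _ = C⁻¹ * η ^ (1 - μ) * ‖(v : H)‖ - (2 * C)⁻¹ * η ^ (1 - μ) * ‖(v : H)‖ := by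
      rw [mul_inv]
      ring
    _ ≤ ‖A v - z • (v : H)‖ := by linarith
end

section
/- Let n ≥ 2 and let q : ℝⁿ × ℝⁿ → ℂ be a complex-valued elliptic quadratic form such that the quadratic form {Re q, Im q} is not identically zero. Suppose P is a linear isomorphism of ℝ^{2n} and α₁, …, α_{2n} are real numbers such that Re q(Py) = Σⱼ yⱼ² and Im q(Py) = Σⱼ αⱼ yⱼ² for all y ∈ ℝ^{2n}. Then for every z belonging to the topological interior of Σ(q) and not belonging to any of the open half-lines (1 + iαⱼ)ℝ₊* for j = 1, …, 2n, there exists a point (x̃₀, ξ̃₀) ∈ ℝ^{2n} such that q(x̃₀, ξ̃₀) = z and {Re q, Im q}(x̃₀, ξ̃₀) < 0. -/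
open Finset in
/-- A quadratic form with vanishing diagonal that is nonnegative at the vertices of the cube
`[-1, 1]^ι` is nonnegative on the whole cube, since it is affine in each coordinate. -/
theorem sum_mul_nonneg_of_nonneg_on_signs {ι : Type*} [Fintype ι] [DecidableEq ι]
    (M : ι → ι → ℝ) (hM : ∀ a, M a a = 0)
    (h : ∀ t : ι → ℝ, (∀ j, t j = 1 ∨ t j = -1) → 0 ≤ ∑ a, ∑ b, M a b * (t a * t b))
    (t : ι → ℝ) (ht : ∀ j, |t j| ≤ 1) :
    0 ≤ ∑ a, ∑ b, M a b * (t a * t b) := by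
  suffices H : ∀ (S : Finset ι) (t : ι → ℝ), (∀ j ∈ S, |t j| ≤ 1) →
      (∀ j ∉ S, t j = 1 ∨ t j = -1) → 0 ≤ ∑ a, ∑ b, M a b * (t a * t b) from
    H univ t (fun j _ => ht j) (fun j hj => absurd (mem_univ j) hj)
  intro S
  induction S using Finset.induction_on with
  | empty => exact fun t _ h2 => h t fun j => h2 j (notMem_empty j)
  | insert i S hi ih =>
    intro t h1 h2
    have vertex : ∀ s : ℝ, (s = 1 ∨ s = -1) →
        0 ≤ ∑ a, ∑ b, M a b * (Function.update t i s a * Function.update t i s b) := by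
      intro s hs
      refine ih _ (fun j hj => ?_) (fun j hj => ?_)
      · have hji : j ≠ i := fun e => hi (e ▸ hj)
        rw [Function.update_of_ne hji]
        exact h1 j (mem_insert_of_mem hj)
      · by_cases hji : j = i
        · subst hji
          simpa using hs
        · rw [Function.update_of_ne hji]
          exact h2 j (by simp [hji, hj])
    have affine : ∑ a, ∑ b, M a b * (t a * t b) =
        (1 + t i) / 2 *
          (∑ a, ∑ b, M a b * (Function.update t i 1 a * Function.update t i 1 b)) +
        (1 - t i) / 2 *
          (∑ a, ∑ b, M a b * (Function.update t i (-1) a * Function.update t i (-1) b)) := by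
      simp only [mul_sum, ← sum_add_distrib]
      refine sum_congr rfl fun a _ => sum_congr rfl fun b _ => ?_
      by_cases ha : a = i <;> by_cases hb : b = i
      · simp [ha, hb, hM]
      · simp only [ha, Function.update_self, Function.update_of_ne hb]
        ring
      · simp only [hb, Function.update_self, Function.update_of_ne ha]
        ring
      · simp only [Function.update_of_ne ha, Function.update_of_ne hb]
        ring
    have hti := abs_le.1 (h1 i (mem_insert_self i S))
    rw [affine]
    exact add_nonneg (mul_nonneg (by linarith) (vertex 1 (Or.inl rfl)))
      (mul_nonneg (by linarith) (vertex (-1) (Or.inr rfl)))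

open Finset in
/-- A quadratic form with vanishing diagonal that is nonnegative on all sign changes of a vector
with nonzero coordinates vanishes identically. -/
theorem sum_mul_eq_zero_of_nonneg_on_signs {ι : Type*} [Fintype ι] [DecidableEq ι]
    (M : ι → ι → ℝ) (hM : ∀ a, M a a = 0) (y : ι → ℝ) (hy : ∀ j, y j ≠ 0)
    (h : ∀ t : ι → ℝ, (∀ j, t j = 1 ∨ t j = -1) →
      0 ≤ ∑ a, ∑ b, M a b * ((t a * y a) * (t b * y b)))
    (v : ι → ℝ) : ∑ a, ∑ b, M a b * (v a * v b) = 0 := by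
  have cube := sum_mul_nonneg_of_nonneg_on_signs (fun a b => M a b * (y a * y b))
    (fun a => by simp [hM]) (fun t ht => (h t ht).trans_eq
      (sum_congr rfl fun a _ => sum_congr rfl fun b _ => by ring))
  have pair : ∀ i j : ι, i ≠ j → ∀ s : ℝ, |s| ≤ 1 →
      0 ≤ s * (M i j + M j i) * (y i * y j) := by
    intro i j hij s hs
    have hc := cube (fun k => if k = i then 1 else if k = j then s else 0) (fun k => by
      split_ifs <;> simp [hs])
    refine hc.trans_eq ?_
    have expand : ∀ f : ι → ℝ, ∑ k, f k * (if k = i then 1 else if k = j then s else 0) =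
        f i + f j * s := by
      intro f
      rw [Fintype.sum_eq_add i j hij (fun k hk => by simp [hk.1, hk.2])]
      simp [hij.symm]
    have : ∀ a, ∑ b, M a b * (y a * y b) * ((if a = i then 1 else if a = j then s else 0) *
        (if b = i then 1 else if b = j then s else 0)) =
        (M a i * (y a * y i) + M a j * (y a * y j) * s) *
          (if a = i then 1 else if a = j then s else 0) := by
      intro a
      rw [← expand fun b => M a b * (y a * y b), sum_mul]
      exact sum_congr rfl fun b _ => by ring
    simp only [this]
    rw [expand, hM, hM]
    ring
  have anti : ∀ i j : ι, M i j = -M j i := by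
    intro i j
    by_cases hij : i = j
    · subst hij
      simp [hM]
    · have h1 := pair i j hij 1 (by simp)
      have h2 := pair i j hij (-1) (by simp)
      have h3 : (M i j + M j i) * (y i * y j) = 0 := by linarith
      have := (mul_eq_zero.1 h3).resolve_right (mul_ne_zero (hy i) (hy j))
      linarith
  have swap : ∑ a, ∑ b, M a b * (v a * v b) = -∑ a, ∑ b, M a b * (v a * v b) := by
    conv_lhs => rw [sum_comm]
    simp only [← sum_neg_distrib]
    exact sum_congr rfl fun a _ => sum_congr rfl fun b _ => by rw [anti b a]; ring
  linarith

/-- The derivative of a form diagonalized by a linear isomorphism. -/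
theorem fderiv_of_diagonalized {ι E : Type*} [Fintype ι] [NormedAddCommGroup E] [NormedSpace ℝ E]
    [FiniteDimensional ℝ E] (P : (ι → ℝ) ≃ₗ[ℝ] E) (β : ι → ℝ) (f : E → ℝ)
    (hf : ∀ y, f (P y) = ∑ j, β j * y j ^ 2) (y : ι → ℝ) (V : E) :
    fderiv ℝ f (P y) V = ∑ j, 2 * β j * y j * P.symm V j := by
  let c : ι → E →L[ℝ] ℝ := fun j =>
    LinearMap.toContinuousLinearMap ((LinearMap.proj j).comp P.symm.toLinearMap)
  have hc : ∀ j X, c j X = P.symm X j := fun _ _ => rfl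
  have hfc : f = fun X => ∑ j, β j * c j X ^ 2 := by
    funext X
    simpa [hc] using hf (P.symm X)
  have hd : HasFDerivAt f (∑ j, β j • ((2 * c j (P y)) • c j)) (P y) := by
    rw [hfc]
    refine HasFDerivAt.fun_sum fun j _ => HasFDerivAt.const_mul ?_ (β j)
    simpa using (c j).hasFDerivAt.pow 2
  rw [hd.fderiv]
  simp only [sum_apply, smul_apply, smul_eq_mul, hc,
    LinearEquiv.symm_apply_apply]
  exact Finset.sum_congr rfl fun j _ => by ring

open Finset in
/-- The Poisson bracket of two simultaneously diagonalized forms is, in the diagonalizing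
coordinates, a quadratic form with vanishing diagonal. -/
theorem exists_poissonBracket_eq_sum {n : ℕ} {ι : Type*} [Fintype ι]
    (P : (ι → ℝ) ≃ₗ[ℝ] ((Fin n → ℝ) × (Fin n → ℝ))) (α β : ι → ℝ)
    (f g : ((Fin n → ℝ) × (Fin n → ℝ)) → ℝ)
    (hf : ∀ y, f (P y) = ∑ j, α j * y j ^ 2) (hg : ∀ y, g (P y) = ∑ j, β j * y j ^ 2) :
    ∃ M : ι → ι → ℝ, (∀ a, M a a = 0) ∧
      ∀ y, poissonBracket f g (P y) = ∑ a, ∑ b, M a b * (y a * y b) := by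
  refine ⟨fun a b => ∑ j, 4 * α a * β b *
      (P.symm (0, Pi.single j 1) a * P.symm (Pi.single j 1, 0) b -
        P.symm (Pi.single j 1, 0) a * P.symm (0, Pi.single j 1) b),
    fun a => sum_eq_zero fun j _ => by ring, fun y => ?_⟩
  simp only [poissonBracket, fderiv_of_diagonalized P α f hf, fderiv_of_diagonalized P β g hg,
    ← sum_sub_distrib, sum_mul]
  rw [sum_comm]
  refine sum_congr rfl fun a _ => ?_
  rw [sum_comm]
  refine sum_congr rfl fun j _ => ?_
  rw [mul_sum, mul_sum, ← sum_sub_distrib]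
  exact sum_congr rfl fun b _ => by ring

/-- Every interior point of the range of a diagonalized form is attained at a vector with
nonzero coordinates. -/
theorem exists_ne_zero_of_mem_interior_range {ι E : Type*} [Fintype ι]
    (P : (ι → ℝ) ≃ E) (α : ι → ℝ) (q : E → ℂ)
    (hre : ∀ y, (q (P y)).re = ∑ j, y j ^ 2) (him : ∀ y, (q (P y)).im = ∑ j, α j * y j ^ 2)
    {z : ℂ} (hz : z ∈ interior (Set.range q)) :
    ∃ y : ι → ℝ, (∀ j, y j ≠ 0) ∧ q (P y) = z := by
  let w : ℂ := ⟨∑ _j : ι, 1, ∑ j, α j⟩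
  have hlim : Filter.Tendsto (fun s : ℝ => z - s * w) (nhds 0) (nhds z) := by
    have : Continuous fun s : ℝ => z - s * w := by fun_prop
    simpa using this.tendsto 0
  have hev := (hlim.eventually (mem_interior_iff_mem_nhds.1 hz)).filter_mono
    (nhdsWithin_le_nhds (s := Set.Ioi 0))
  obtain ⟨s, ⟨X, hX⟩, hs⟩ := (hev.and self_mem_nhdsWithin).exists
  obtain ⟨u, rfl⟩ := P.surjective X
  have hs : 0 < s := hs
  have hpos : ∀ j, 0 < u j ^ 2 + s := fun j => by positivity
  refine ⟨fun j => √(u j ^ 2 + s), fun j => (Real.sqrt_pos.2 (hpos j)).ne', ?_⟩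
  have hXre := congrArg Complex.re hX
  have hXim := congrArg Complex.im hX
  rw [hre] at hXre
  rw [him] at hXim
  simp only [Complex.sub_re, Complex.sub_im, Complex.re_ofReal_mul, Complex.im_ofReal_mul, w,
    Finset.mul_sum] at hXre hXim
  apply Complex.ext
  · rw [hre]
    simp only [Real.sq_sqrt (hpos _).le, Finset.sum_add_distrib]
    simp only [mul_one] at hXre
    linarith
  · rw [him]
    simp only [Real.sq_sqrt (hpos _).le, mul_add, Finset.sum_add_distrib]
    simp only [mul_comm s] at hXim
    linarith

/-- for a non-normal elliptic quadratic form `q` in dimension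
`n ≥ 2`, simultaneously diagonalized via an isomorphism `P` of `ℝ^{2n}` as
`Re q(Py) = ∑ yⱼ²`, `Im q(Py) = ∑ αⱼ yⱼ²`, every interior point `z` of the
numerical range avoiding the half-lines `(1 + iαⱼ)ℝ₊*` is attained at a
point where `{Re q, Im q} < 0`. -/
theorem exists_negative_bracket_point {n : ℕ} (hn : 2 ≤ n)
    (q : ((Fin n → ℝ) × (Fin n → ℝ)) → ℂ)
    (hq : IsCQuadForm q)
    (hell : ∀ X, q X = 0 → X = 0)
    (hnn : ∃ X, poissonBracket (fun X => (q X).re) (fun X => (q X).im) X ≠ 0)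
    (P : (Fin (2 * n) → ℝ) ≃ₗ[ℝ] ((Fin n → ℝ) × (Fin n → ℝ)))
    (α : Fin (2 * n) → ℝ)
    (hre : ∀ y : Fin (2 * n) → ℝ, (q (P y)).re = ∑ j, (y j) ^ 2)
    (him : ∀ y : Fin (2 * n) → ℝ, (q (P y)).im = ∑ j, α j * (y j) ^ 2) :
    ∀ z : ℂ, z ∈ interior (Set.range q) →
      (∀ j : Fin (2 * n), ∀ t : ℝ, 0 < t → z ≠ (t : ℂ) * (1 + Complex.I * (α j : ℂ))) →
      ∃ X : (Fin n → ℝ) × (Fin n → ℝ), q X = z ∧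
        poissonBracket (fun X => (q X).re) (fun X => (q X).im) X < 0 := by
  intro z hz _
  obtain ⟨M, hM, hbr⟩ := exists_poissonBracket_eq_sum P (fun _ => 1) α
    (fun X => (q X).re) (fun X => (q X).im) (by simpa using hre) him
  obtain ⟨y, hy, rfl⟩ := exists_ne_zero_of_mem_interior_range P.toEquiv α q hre him hz
  obtain ⟨X, hX⟩ := hnn
  obtain ⟨v, rfl⟩ := P.surjective X
  by_contra! hcon
  refine hX ((hbr v).trans (sum_mul_eq_zero_of_nonneg_on_signs M hM y hy (fun t ht => ?_) v))
  have hsq : ∀ j, (t j * y j) ^ 2 = y j ^ 2 := fun j => by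
    rcases ht j with h | h <;> simp [h]
  have hval : q (P fun j => t j * y j) = q (P y) := by
    apply Complex.ext
    · simp only [hre, hsq]
    · simp only [him, hsq]
  exact (hcon _ hval).trans_eq (hbr _)
end
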